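/- arXiv:1902.01508 — 9 statements merged into one kernel-verified Lean document; each statement's English description precedes it below -/
import Mathlib

section
/- Let D ⊆ ω^ω be a dominating family consisting of increasing functions, and for each f ∈ D let σ^f : ℕ → 2^{<ω} be a sequence of finite binary sequences with |σ^f(n)| = f*(n) for all n. Then for every perfect tree T ⊆ 2^{<ω} there exist a perfect tree S ⊆ T and f ∈ D such that [σ^f]_∞ ∩ [S] = ∅. -/
/-- `s` is an initial segment of `x : ℕ → Bool`. -/
def IsInitSeg (s : List Bool) (x : ℕ → Bool) : Prop :=
  ∀ i : Fin s.length, s.get i = x i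

/-- A perfect tree: a nonempty set of finite binary sequences, closed under initial
segments, in which every node is extended by a node splitting into both successors. -/
def IsPerfectTree (T : Set (List Bool)) : Prop :=
  T.Nonempty ∧ (∀ t ∈ T, ∀ s, s <+: t → s ∈ T) ∧
    ∀ s ∈ T, ∃ t ∈ T, s <+: t ∧ t ++ [false] ∈ T ∧ t ++ [true] ∈ T

/-- `[T]`: the set of infinite branches of `T`. -/
def branches (T : Set (List Bool)) : Set (ℕ → Bool) :=
  {x | ∀ n, (List.ofFn fun i : Fin n => x i) ∈ T}

/-- `[σ]_∞`: the set of `x ∈ 2^ω` such that `σ n` is an initial segment of `x`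
for infinitely many `n`. -/
def limsupCyl (σ : ℕ → List Bool) : Set (ℕ → Bool) :=
  {x | ∀ m, ∃ n ≥ m, IsInitSeg (σ n) x}

/-- `f ≤* g`: `f n ≤ g n` for all but finitely many `n`. -/
def LeStar (f g : ℕ → ℕ) : Prop := ∀ᶠ n in Filter.atTop, f n ≤ g n

/-- `f*`: `f* 0 = 0`, `f* (n+1) = f (f* n + 1)`. -/
def fstar (f : ℕ → ℕ) : ℕ → ℕ
  | 0 => 0
  | n + 1 => f (fstar f n + 1)

namespace IsPerfectTree

variable {T : Set (List Bool)}

theorem exists_extension_length (hT : IsPerfectTree T) {t : List Bool} (ht : t ∈ T) {m : ℕ}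
    (hm : t.length ≤ m) : ∃ u ∈ T, t <+: u ∧ u.length = m := by
  induction m, hm using Nat.le_induction with
  | base => exact ⟨t, ht, List.prefix_rfl, rfl⟩
  | succ m _ ih =>
    obtain ⟨u, hu, htu, hlen⟩ := ih
    obtain ⟨v, -, huv, hv, -⟩ := hT.2.2 u hu
    refine ⟨(v ++ [false]).take (m + 1), hT.2.1 _ hv _ (List.take_prefix _ _), ?_, ?_⟩
    · refine htu.trans (List.prefix_take_iff.2 ⟨huv.trans (List.prefix_append _ _), by omega⟩)
    · have := huv.length_le
      simp only [List.length_take, List.length_append, List.length_singleton]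
      omega

theorem exists_three_extensions (hT : IsPerfectTree T) {t : List Bool} (ht : t ∈ T) :
    ∃ k, ∀ m ≥ k, ∃ u v w, (u ∈ T ∧ t <+: u ∧ u.length = m) ∧ (v ∈ T ∧ t <+: v ∧ v.length = m) ∧
      (w ∈ T ∧ t <+: w ∧ w.length = m) ∧ u ≠ v ∧ u ≠ w ∧ v ≠ w := by
  obtain ⟨p, -, htp, hp0, hp1⟩ := hT.2.2 t ht
  obtain ⟨q, -, hpq, hq0, hq1⟩ := hT.2.2 _ hp1
  have hpq_len := hpq.length_le
  simp only [List.length_append, List.length_singleton] at hpq_len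
  have split : ∀ {r x y : List Bool}, r ++ [false] <+: x → r ++ [true] <+: y → x ≠ y := by
    rintro r x _ hx hy rfl
    have := (List.prefix_of_prefix_length_le hx hy (by simp)).eq_of_length (by simp)
    simp at this
  refine ⟨q.length + 1, fun m hm => ?_⟩
  obtain ⟨u, hu, hpu, hul⟩ := hT.exists_extension_length hp0 (m := m) (by simp; omega)
  obtain ⟨v, hv, hqv, hvl⟩ := hT.exists_extension_length hq0 (m := m) (by simpa using hm)
  obtain ⟨w, hw, hqw, hwl⟩ := hT.exists_extension_length hq1 (m := m) (by simpa using hm)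
  have hpv := hpq.trans ((List.prefix_append _ _).trans hqv)
  have hpw := hpq.trans ((List.prefix_append _ _).trans hqw)
  have htp' : ∀ {b x}, p ++ [b] <+: x → t <+: x := fun h =>
    htp.trans ((List.prefix_append _ _).trans h)
  exact ⟨u, v, w, ⟨hu, htp' hpu, hul⟩, ⟨hv, htp' hpv, hvl⟩, ⟨hw, htp' hpw, hwl⟩,
    split hpu hpv, split hpu hpw, split hqv hqw⟩

theorem exists_two_extensions_ne (hT : IsPerfectTree T) :
    ∃ g : ℕ → ℕ, ∀ t ∈ T, ∀ m ≥ g t.length, ∀ s, ∃ u v,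
      (u ∈ T ∧ t <+: u ∧ u.length = m ∧ u ≠ s) ∧ (v ∈ T ∧ t <+: v ∧ v.length = m ∧ v ≠ s) ∧
      u ≠ v := by
  have key : ∀ t, ∃ k, t ∈ T → ∀ m ≥ k, ∀ s, ∃ u v,
      (u ∈ T ∧ t <+: u ∧ u.length = m ∧ u ≠ s) ∧ (v ∈ T ∧ t <+: v ∧ v.length = m ∧ v ≠ s) ∧
      u ≠ v := by
    intro t
    by_cases ht : t ∈ T
    · obtain ⟨k, hk⟩ := hT.exists_three_extensions ht
      refine ⟨k, fun _ m hm s => ?_⟩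
      obtain ⟨u, v, w, ⟨hu, htu, hul⟩, ⟨hv, htv, hvl⟩, ⟨hw, htw, hwl⟩, huv, huw, hvw⟩ := hk m hm
      by_cases hus : u = s
      · subst hus
        exact ⟨v, w, ⟨hv, htv, hvl, huv.symm⟩, ⟨hw, htw, hwl, huw.symm⟩, hvw⟩
      · by_cases hvs : v = s
        · subst hvs
          exact ⟨u, w, ⟨hu, htu, hul, hus⟩, ⟨hw, htw, hwl, hvw.symm⟩, huw⟩
        · exact ⟨u, v, ⟨hu, htu, hul, hus⟩, ⟨hv, htv, hvl, hvs⟩, huv⟩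
    · exact ⟨0, fun h => absurd h ht⟩
  choose k hk using key
  have bdd : ∀ n, ∃ b, ∀ t : List Bool, t.length = n → k t ≤ b := fun n => by
    obtain ⟨b, hb⟩ := ((List.finite_length_eq Bool n).image k).bddAbove
    exact ⟨b, fun t ht => hb ⟨t, ht, rfl⟩⟩
  choose g hg using bdd
  exact ⟨g, fun t ht m hm => hk t ht m ((hg _ t rfl).trans hm)⟩

end IsPerfectTree

theorem exists_split_of_ne_of_length_eq {u v w : List Bool} (hu : w <+: u) (hv : w <+: v)
    (hlen : u.length = v.length) (hne : u ≠ v) :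
    ∃ t b, w <+: t ∧ t ++ [b] <+: u ∧ t ++ [!b] <+: v := by
  obtain ⟨u, rfl⟩ := hu
  obtain ⟨v, rfl⟩ := hv
  induction u generalizing w v with
  | nil =>
    have : v = [] := by simpa using hlen.symm
    simp [this] at hne
  | cons a u ih =>
    cases v with
    | nil => simp at hlen
    | cons c v =>
      by_cases hac : c = a
      · subst hac
        obtain ⟨t, b, hwt, h₁, h₂⟩ := ih (w := w ++ [c]) v (by simpa using hlen) (by simpa using hne)
        exact ⟨t, b, (List.prefix_append _ _).trans hwt, by simpa using h₁, by simpa using h₂⟩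
      · refine ⟨w, a, List.prefix_rfl, by simp, ?_⟩
        rw [← Bool.eq_not_of_ne hac]
        simp

/-- A set of nodes in which every node has two distinct proper extensions of equal length
generates a perfect tree. -/
theorem isPerfectTree_prefixes {B : Set (List Bool)} (hne : B.Nonempty)
    (hsplit : ∀ w ∈ B, ∃ u ∈ B, ∃ v ∈ B, w <+: u ∧ w <+: v ∧ u.length = v.length ∧ u ≠ v) :
    IsPerfectTree {t | ∃ u ∈ B, t <+: u} := by
  refine ⟨hne.mono fun u hu => ⟨u, hu, List.prefix_rfl⟩, ?_, ?_⟩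
  · rintro t ⟨u, hu, htu⟩ s hst
    exact ⟨u, hu, hst.trans htu⟩
  · rintro s ⟨w, hw, hsw⟩
    obtain ⟨u, hu, v, hv, hwu, hwv, hlen, huv⟩ := hsplit w hw
    obtain ⟨t, b, hwt, htu, htv⟩ := exists_split_of_ne_of_length_eq hwu hwv hlen huv
    refine ⟨t, ⟨u, hu, (List.prefix_append _ _).trans htu⟩, hsw.trans hwt, ?_⟩
    cases b
    · exact ⟨⟨u, hu, htu⟩, ⟨v, hv, htv⟩⟩
    · exact ⟨⟨v, hv, htv⟩, ⟨u, hu, htu⟩⟩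

theorem strictMono_fstar {f : ℕ → ℕ} (hf : StrictMono f) : StrictMono (fstar f) :=
  strictMono_nat_of_lt_succ fun n => (Nat.lt_succ_self _).trans_le (hf.le_apply (x := fstar f n + 1))

theorem IsInitSeg.ofFn_eq {s : List Bool} {x : ℕ → Bool} (h : IsInitSeg s x) :
    (List.ofFn fun i : Fin s.length => x i) = s := by
  conv_rhs => rw [← List.ofFn_get s]
  exact congrArg List.ofFn (funext fun i => (h i).symm)

/-- Let `D` be a dominating family of increasing functions and, for each `f ∈ D`,
let `σ f : ℕ → 2^{<ω}` satisfy `|σ f n| = f* n` for all `n`. Then for every perfect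
tree `T` there are a perfect tree `S ⊆ T` and `f ∈ D` with `[σ f]_∞ ∩ [S] = ∅`. -/
theorem stmt1 (D : Set (ℕ → ℕ)) (hdom : ∀ g : ℕ → ℕ, ∃ f ∈ D, LeStar g f)
    (hinc : ∀ f ∈ D, StrictMono f)
    (σ : (ℕ → ℕ) → ℕ → List Bool)
    (hσ : ∀ f ∈ D, ∀ n, (σ f n).length = fstar f n)
    (T : Set (List Bool)) (hT : IsPerfectTree T) :
    ∃ S, IsPerfectTree S ∧ S ⊆ T ∧ ∃ f ∈ D, limsupCyl (σ f) ∩ branches S = ∅ := by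
  obtain ⟨g, hg⟩ := hT.exists_two_extensions_ne
  obtain ⟨f, hfD, hgf⟩ := hdom g
  obtain ⟨N, hN⟩ := Filter.eventually_atTop.1 hgf
  have hmono := strictMono_fstar (hinc f hfD)
  have hlen := hσ f hfD
  let A : Set (List Bool) := {t | t ∈ T ∧ ∀ n > N, ¬ σ f n <+: t}
  let B : Set (List Bool) := {t | t ∈ A ∧ ∃ n ≥ N, t.length = fstar f n}
  have hnonempty : B.Nonempty := by
    obtain ⟨r, hr⟩ := hT.1
    obtain ⟨u, hu, -, hul⟩ := hT.exists_extension_length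
      (hT.2.1 r hr [] List.nil_prefix) (Nat.zero_le (fstar f N))
    refine ⟨u, ⟨hu, fun n hn hp => ?_⟩, N, le_rfl, hul⟩
    have := hp.length_le
    have := hmono hn
    have := hlen n
    omega
  have hsplit : ∀ w ∈ B, ∃ u ∈ B, ∃ v ∈ B,
      w <+: u ∧ w <+: v ∧ u.length = v.length ∧ u ≠ v := by
    rintro w ⟨⟨hwT, hwσ⟩, n, hn, hwl⟩
    obtain ⟨w', hw', hww', hwl'⟩ := hT.exists_extension_length hwT (Nat.le_succ _)
    have hle : g w'.length ≤ fstar f (n + 1) := by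
      rw [hwl', hwl]
      exact hN _ (hn.trans ((hmono.le_apply (x := n)).trans (Nat.le_succ _)))
    have mem : ∀ x, x ∈ T ∧ w' <+: x ∧ x.length = fstar f (n + 1) ∧ x ≠ σ f (n + 1) → x ∈ B := by
      rintro x ⟨hx, hwx, hxl, hxσ⟩
      refine ⟨⟨hx, fun m hm hp => ?_⟩, n + 1, hn.trans (Nat.le_succ n), hxl⟩
      have hmn : m ≤ n + 1 := hmono.le_iff_le.1 (by simpa [hlen, hxl] using hp.length_le)
      rcases hmn.eq_or_lt with rfl | hmn
      · exact hxσ (hp.eq_of_length (by rw [hlen, hxl])).symm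
      · refine hwσ m hm (List.prefix_of_prefix_length_le hp (hww'.trans hwx) ?_)
        rw [hlen, hwl]
        exact hmono.monotone (Nat.lt_succ_iff.1 hmn)
    obtain ⟨u, v, hu, hv, huv⟩ := hg w' hw' _ hle (σ f (n + 1))
    exact ⟨u, mem u hu, v, mem v hv, hww'.trans hu.2.1, hww'.trans hv.2.1,
      hu.2.2.1.trans hv.2.2.1.symm, huv⟩
  refine ⟨_, isPerfectTree_prefixes hnonempty hsplit, ?_, f, hfD, ?_⟩
  · rintro t ⟨u, hu, htu⟩
    exact hT.2.1 u hu.1.1 t htu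
  · refine Set.eq_empty_of_forall_notMem ?_
    rintro x ⟨hxσ, hxS⟩
    obtain ⟨n, hn, hx⟩ := hxσ (N + 1)
    obtain ⟨u, hu, hxu⟩ := hxS (σ f n).length
    rw [hx.ofFn_eq] at hxu
    exact hu.1.2 n hn hxu
end

section
/- Every strong measure zero subset of 2^ω belongs to the Marczewski ideal s⁰; that is, SN(2^ω) ⊆ s⁰. -/
/-- `[s]`: the basic clopen set of `x ∈ 2^ω` with initial segment `s`. -/
def cyl (s : List Bool) : Set (ℕ → Bool) := {x | IsInitSeg s x}

/-- `X ⊆ 2^ω` has strong measure zero: for every `f : ℕ → ℕ` there is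
`σ : ℕ → 2^{<ω}` with `|σ n| = f n` for all `n` such that `X ⊆ ⋃ n, [σ n]`. -/
def SMZ2 (X : Set (ℕ → Bool)) : Prop :=
  ∀ f : ℕ → ℕ, ∃ σ : ℕ → List Bool, (∀ n, (σ n).length = f n) ∧ X ⊆ ⋃ n, cyl (σ n)

/-- `X` belongs to the Marczewski ideal `s⁰`: for every perfect tree `T` there is
a perfect tree `S ⊆ T` with `[S] ∩ X = ∅`. -/
def Marczewski (X : Set (ℕ → Bool)) : Prop :=
  ∀ T, IsPerfectTree T → ∃ S, IsPerfectTree S ∧ S ⊆ T ∧ branches S ∩ X = ∅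

/-- A map of finite binary sequences into a tree `T` along its splitting nodes: `e` sends a node
to a splitting node above it. Sequences are read from right to left, so that `b :: s` is a
successor of `s`. -/
def splitMap (e : List Bool → List Bool) : List Bool → List Bool
  | [] => e []
  | b :: s => e (splitMap e s ++ [b])

/-- The bits of `s` (read from right to left) at the odd positions `2 * n + 1` are `c n`. -/
def OddBits (c : ℕ → Bool) : List Bool → Prop
  | [] => True
  | b :: s => OddBits c s ∧ ∀ n, s.length = 2 * n + 1 → b = c n

theorem OddBits.of_suffix {c : ℕ → Bool} {s u : List Bool} (hs : OddBits c s) (h : u <:+ s) :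
    OddBits c u := by
  induction s with
  | nil => rw [List.suffix_nil.mp h]; trivial
  | cons b s ih =>
    rcases List.suffix_cons_iff.mp h with rfl | h
    · exact hs
    · exact ih hs.1 h

theorem OddBits.exists_even_extension {c : ℕ → Bool} {s : List Bool} (hs : OddBits c s) :
    ∃ u, OddBits c u ∧ s <:+ u ∧ Even u.length := by
  rcases Nat.even_or_odd s.length with h | ⟨n, h⟩
  · exact ⟨s, hs, List.suffix_rfl, h⟩
  · refine ⟨c n :: s, ⟨hs, fun m hm => ?_⟩, List.suffix_cons _ _, ⟨n + 1, ?_⟩⟩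
    · congr 1; omega
    · simp only [List.length_cons]; omega

theorem splitMap_mem {T : Set (List Bool)} {e : List Bool → List Bool} (hnil : [] ∈ T)
    (he : ∀ s ∈ T, e s ∈ T ∧ s <+: e s ∧ e s ++ [false] ∈ T ∧ e s ++ [true] ∈ T)
    (s : List Bool) : splitMap e s ∈ T ∧ ∀ b, splitMap e s ++ [b] ∈ T := by
  induction s with
  | nil =>
    obtain ⟨h, -, h0, h1⟩ := he _ hnil
    exact ⟨h, fun b => by cases b; exacts [h0, h1]⟩
  | cons a s ih =>
    obtain ⟨h, -, h0, h1⟩ := he _ (ih.2 a)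
    exact ⟨h, fun b => by cases b; exacts [h0, h1]⟩

section splitMap

variable {e : List Bool → List Bool}

theorem splitMap_prefix_of_suffix (he : ∀ s b, splitMap e s ++ [b] <+: splitMap e (b :: s))
    {s u : List Bool} (h : u <:+ s) : splitMap e u <+: splitMap e s := by
  induction s with
  | nil => rw [List.suffix_nil.mp h]
  | cons b s ih =>
    rcases List.suffix_cons_iff.mp h with rfl | h
    · exact List.prefix_rfl
    · exact (ih h).trans ((List.prefix_append _ _).trans (he s b))

theorem eq_of_splitMap_prefix (he : ∀ s b, splitMap e s ++ [b] <+: splitMap e (b :: s))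
    {t : List Bool} {u v : List Bool} (hlen : u.length = v.length)
    (hu : splitMap e u <+: t) (hv : splitMap e v <+: t) : u = v := by
  induction u generalizing v with
  | nil => exact (List.length_eq_zero_iff.mp hlen.symm).symm
  | cons a u ih =>
    cases v with
    | nil => simp at hlen
    | cons b v =>
      have hu' := (he u a).trans hu
      have hv' := (he v b).trans hv
      obtain rfl := ih (by simpa using hlen) ((List.prefix_append _ _).trans hu')
        ((List.prefix_append _ _).trans hv')
      have := (List.prefix_of_prefix_length_le hu' hv' (by simp)).eq_of_length (by simp)
      simpa using this

theorem exists_bit_not_splitMap_prefix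
    (he : ∀ s b, splitMap e s ++ [b] <+: splitMap e (b :: s)) (t : List Bool) (m : ℕ) :
    ∃ c : Bool, ∀ u : List Bool, u.length = m → ¬ splitMap e (c :: u) <+: t := by
  by_contra! h
  obtain ⟨u, hu, hut⟩ := h false
  obtain ⟨v, hv, hvt⟩ := h true
  have := eq_of_splitMap_prefix he (by simp [hu, hv]) hut hvt
  simp at this

theorem exists_length_splitMap_lt (e : List Bool → List Bool) (m : ℕ) :
    ∃ N, ∀ s : List Bool, s.length ≤ m → (splitMap e s).length < N := by
  obtain ⟨N, hN⟩ := ((List.finite_length_le Bool m).image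
    fun s => (splitMap e s).length).bddAbove
  exact ⟨N + 1, fun s hs => Nat.lt_succ_of_le (hN ⟨s, hs, rfl⟩)⟩

end splitMap

theorem ofFn_eq_of_mem_cyl {s : List Bool} {x : ℕ → Bool} (h : x ∈ cyl s) :
    (List.ofFn fun i : Fin s.length => x i) = s := by
  rw [← funext h]
  exact List.ofFn_get s

/-- Every strong measure zero subset of `2^ω` belongs to the Marczewski ideal `s⁰`. -/
theorem stmt2 (X : Set (ℕ → Bool)) (hX : SMZ2 X) : Marczewski X := by
  intro T ⟨⟨t₀, ht₀⟩, hdown, hsplit⟩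
  have hnil : [] ∈ T := hdown t₀ ht₀ [] List.nil_prefix
  choose! e he using hsplit
  have hmem := splitMap_mem hnil he
  have hext : ∀ s b, splitMap e s ++ [b] <+: splitMap e (b :: s) :=
    fun s b => (he _ ((hmem s).2 b)).2.1
  choose f hf using fun n => exists_length_splitMap_lt e (2 * n + 2)
  obtain ⟨σ, hσ, hcover⟩ := hX f
  choose c hc using fun n => exists_bit_not_splitMap_prefix hext (σ n) (2 * n + 1)
  refine ⟨{t | ∃ s, OddBits c s ∧ t <+: splitMap e s}, ⟨⟨[], [], trivial, List.nil_prefix⟩,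
    fun t ⟨s, hs, hts⟩ r hr => ⟨s, hs, hr.trans hts⟩, ?_⟩,
    fun t ⟨s, _, hts⟩ => hdown _ (hmem s).1 _ hts, ?_⟩
  · rintro t ⟨s, hs, hts⟩
    obtain ⟨u, hu, hsu, k, hk⟩ := hs.exists_even_extension
    have hcons : ∀ b, OddBits c (b :: u) := fun b => ⟨hu, fun n hn => by omega⟩
    exact ⟨splitMap e u, ⟨u, hu, List.prefix_rfl⟩,
      hts.trans (splitMap_prefix_of_suffix hext hsu),
      ⟨_, hcons false, hext _ _⟩, ⟨_, hcons true, hext _ _⟩⟩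
  · refine Set.eq_empty_of_forall_notMem fun x ⟨hxS, hxX⟩ => ?_
    obtain ⟨n, hn⟩ := Set.mem_iUnion.mp (hcover hxX)
    obtain ⟨s, hs, hσs⟩ := hxS (σ n).length
    rw [ofFn_eq_of_mem_cyl hn] at hσs
    have hlen : 2 * n + 2 < s.length := by
      by_contra! h
      have := hf n s h
      have := hσs.length_le
      have := hσ n
      omega
    have hsuff := List.drop_suffix (s.length - (2 * n + 2)) s
    have hdrop : (s.drop (s.length - (2 * n + 2))).length = 2 * n + 2 := by
      rw [List.length_drop]; omega
    generalize s.drop (s.length - (2 * n + 2)) = w at hsuff hdrop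
    obtain _ | ⟨b, u⟩ := w
    · simp at hdrop
    have hu : u.length = 2 * n + 1 := by simpa using hdrop
    obtain rfl := (hs.of_suffix hsuff).2 n hu
    refine hc n u hu (List.prefix_of_prefix_length_le
      (splitMap_prefix_of_suffix hext hsuff) hσs ?_)
    rw [hσ]
    exact (hf n _ hdrop.le).le
end

section
/- Every subset of 2^ω of cardinality less than 𝔠 = 2^{ℵ₀} belongs to the Marczewski ideal s⁰; consequently non(s⁰) = 𝔠, i.e., the least cardinality of a subset of 2^ω not in s⁰ equals 𝔠. -/
open Cardinal

theorem isInitSeg_iff {s : List Bool} {x : ℕ → Bool} :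
    IsInitSeg s x ↔ ∀ i (h : i < s.length), s[i] = x i :=
  ⟨fun h i hi => h ⟨i, hi⟩, fun h i => h i i.2⟩

theorem IsInitSeg.of_prefix {s t : List Bool} {x : ℕ → Bool} (ht : IsInitSeg t x)
    (h : s <+: t) : IsInitSeg s x := by
  rw [isInitSeg_iff] at *
  intro i hi
  rw [h.getElem hi]
  exact ht i _

theorem IsInitSeg.eq_of_append_singleton {s : List Bool} {b : Bool} {x : ℕ → Bool}
    (h : IsInitSeg (s ++ [b]) x) : b = x s.length := by
  rw [isInitSeg_iff] at h
  simpa using h s.length (by simp)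

theorem IsInitSeg.ofFn_prefix {s : List Bool} {x : ℕ → Bool} (h : IsInitSeg s x) {n : ℕ}
    (hn : n ≤ s.length) : (List.ofFn fun i : Fin n => x i) <+: s := by
  rw [isInitSeg_iff] at h
  rw [List.prefix_iff_eq_take]
  refine List.ext_getElem (by simp [hn]) fun i h₁ h₂ => ?_
  simp only [List.length_take, List.length_ofFn, lt_inf_iff] at h₂
  simp [h i h₂.2]

theorem isInitSeg_ofFn (x : ℕ → Bool) (n : ℕ) :
    IsInitSeg (List.ofFn fun i : Fin n => x i) x := by
  rw [isInitSeg_iff]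
  intro i hi
  simp

/-- `g` maps every node of `T` to a splitting node of `T` above it. -/
def IsSplitting (T : Set (List Bool)) (g : List Bool → List Bool) : Prop :=
  ∀ s ∈ T, s <+: g s ∧ ∀ b, g s ++ [b] ∈ T

theorem IsPerfectTree.exists_isSplitting {T : Set (List Bool)} (hT : IsPerfectTree T) :
    ∃ g, IsSplitting T g := by
  have h : ∀ s, ∃ t, s ∈ T → s <+: t ∧ ∀ b, t ++ [b] ∈ T := by
    intro s
    by_cases hs : s ∈ T
    · obtain ⟨t, -, hst, h₀, h₁⟩ := hT.2.2 s hs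
      exact ⟨t, fun _ => ⟨hst, fun b => by cases b <;> assumption⟩⟩
    · exact ⟨[], fun h => absurd h hs⟩
  choose g hg using h
  exact ⟨g, hg⟩

theorem IsPerfectTree.nil_mem {T : Set (List Bool)} (hT : IsPerfectTree T) : [] ∈ T := by
  obtain ⟨t, ht⟩ := hT.1
  exact hT.2.1 t ht [] List.nil_prefix

/-- An increasing sequence of finite sequences of unbounded length converges to a point. -/
theorem exists_forall_isInitSeg (a : ℕ → List Bool) (ha : ∀ n, a n <+: a (n + 1))
    (hlen : ∀ n, n ≤ (a n).length) : ∃ x, ∀ n, IsInitSeg (a n) x := by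
  have hmono : ∀ {m n}, m ≤ n → a m <+: a n := fun {m n} h =>
    Nat.le_induction List.prefix_rfl (fun k _ ih => ih.trans (ha k)) n h
  refine ⟨fun i => (a (i + 1))[i]'(hlen (i + 1)), fun n => isInitSeg_iff.2 fun i hi => ?_⟩
  rcases le_total n (i + 1) with h | h
  · exact (hmono h).getElem hi
  · exact ((hmono h).getElem (hlen (i + 1))).symm

theorem IsPerfectTree.branches_nonempty {T : Set (List Bool)} (hT : IsPerfectTree T) :
    (branches T).Nonempty := by
  obtain ⟨g, hg⟩ := hT.exists_isSplitting
  let a : ℕ → List Bool := fun n => n.rec [] fun _ s => g s ++ [false]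
  have hmem : ∀ n, a n ∈ T := by
    intro n
    induction n with
    | zero => exact hT.nil_mem
    | succ n ih => exact (hg _ ih).2 false
  have hlen : ∀ n, n ≤ (a n).length := by
    intro n
    induction n with
    | zero => exact Nat.zero_le _
    | succ n ih =>
      have h := (hg _ (hmem n)).1.length_le
      change n + 1 ≤ (g (a n) ++ [false]).length
      rw [List.length_append, List.length_singleton]
      omega
  obtain ⟨x, hx⟩ := exists_forall_isInitSeg a
    (fun n => (hg _ (hmem n)).1.trans (List.prefix_append _ _)) hlen
  exact ⟨x, fun n => hT.2.1 _ (hmem n) _ ((hx n).ofFn_prefix (hlen n))⟩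

theorem isPerfectTree_univ : IsPerfectTree Set.univ :=
  ⟨Set.univ_nonempty, fun _ _ _ _ => trivial, fun s _ => ⟨s, by simp⟩⟩

theorem not_marczewski_univ : ¬ Marczewski Set.univ := by
  intro h
  obtain ⟨S, hS, -, hdisj⟩ := h Set.univ isPerfectTree_univ
  rw [Set.inter_univ] at hdisj
  exact hS.branches_nonempty.ne_empty hdisj

/-- The node reached by going through splitting nodes, alternately turning as `z` says and as
the (reversed) list says. -/
def codedNode (g : List Bool → List Bool) (z : ℕ → Bool) : List Bool → List Bool
  | [] => []
  | c :: l => g (g (codedNode g z l) ++ [z l.length]) ++ [c]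

/-- The subtree generated by the coded nodes, in which every other splitting is decided
by `z`. -/
def codedTree (g : List Bool → List Bool) (z : ℕ → Bool) : Set (List Bool) :=
  {t | ∃ l, t <+: codedNode g z l}

section

variable {T : Set (List Bool)} {g : List Bool → List Bool}

theorem codedNode_mem (hT : IsPerfectTree T) (hg : IsSplitting T g) (z : ℕ → Bool)
    (l : List Bool) : codedNode g z l ∈ T := by
  induction l with
  | nil => exact hT.nil_mem
  | cons c l ih => exact (hg _ ((hg _ ih).2 _)).2 c

theorem append_prefix_codedNode_cons (hT : IsPerfectTree T) (hg : IsSplitting T g)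
    (z : ℕ → Bool) (c : Bool) (l : List Bool) :
    g (codedNode g z l) ++ [z l.length] <+: codedNode g z (c :: l) :=
  (hg _ ((hg _ (codedNode_mem hT hg z l)).2 _)).1.trans (List.prefix_append _ _)

theorem codedNode_prefix_cons (hT : IsPerfectTree T) (hg : IsSplitting T g)
    (z : ℕ → Bool) (c : Bool) (l : List Bool) :
    codedNode g z l <+: codedNode g z (c :: l) :=
  ((hg _ (codedNode_mem hT hg z l)).1.trans (List.prefix_append _ _)).trans
    (append_prefix_codedNode_cons hT hg z c l)

theorem codedNode_prefix_append (hT : IsPerfectTree T) (hg : IsSplitting T g)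
    (z : ℕ → Bool) (k l : List Bool) : codedNode g z l <+: codedNode g z (k ++ l) := by
  induction k with
  | nil => exact List.prefix_rfl
  | cons c k ih => exact ih.trans (codedNode_prefix_cons hT hg z c (k ++ l))

theorem codedTree_subset (hT : IsPerfectTree T) (hg : IsSplitting T g) (z : ℕ → Bool) :
    codedTree g z ⊆ T := by
  rintro t ⟨l, hl⟩
  exact hT.2.1 _ (codedNode_mem hT hg z l) t hl

theorem isPerfectTree_codedTree (hT : IsPerfectTree T) (hg : IsSplitting T g)
    (z : ℕ → Bool) : IsPerfectTree (codedTree g z) := by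
  refine ⟨⟨[], [], List.nil_prefix⟩, fun t ⟨l, hl⟩ s hs => ⟨l, hs.trans hl⟩, ?_⟩
  rintro s ⟨l, hl⟩
  have hmem := codedNode_mem hT hg z l
  refine ⟨g (g (codedNode g z l) ++ [z l.length]), ⟨false :: l, List.prefix_append _ _⟩, ?_,
    ⟨false :: l, List.prefix_rfl⟩, ⟨true :: l, List.prefix_rfl⟩⟩
  exact ((hl.trans (hg _ hmem).1).trans (List.prefix_append _ _)).trans
    (hg _ ((hg _ hmem).2 _)).1

theorem exists_isInitSeg_codedNode (hT : IsPerfectTree T) (hg : IsSplitting T g)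
    {z x : ℕ → Bool} (hx : x ∈ branches (codedTree g z)) (m : ℕ) :
    ∃ l : List Bool, l.length = m ∧ IsInitSeg (codedNode g z l) x := by
  obtain ⟨N, hN⟩ := ((List.finite_length_le Bool m).image
    fun l => (codedNode g z l).length).bddAbove
  have hN' : ∀ l : List Bool, l.length ≤ m → (codedNode g z l).length ≤ N := fun l hl =>
    hN ⟨l, hl, rfl⟩
  obtain ⟨l, hl⟩ := hx (N + 1)
  have hlm : m < l.length := by
    by_contra! h
    have h₁ := hl.length_le
    have h₂ := hN' l h
    rw [List.length_ofFn] at h₁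
    omega
  have hlen : (l.drop (l.length - m)).length = m := by
    rw [List.length_drop]
    omega
  refine ⟨l.drop (l.length - m), hlen, (isInitSeg_ofFn x (N + 1)).of_prefix ?_⟩
  refine List.prefix_of_prefix_length_le ?_ hl ?_
  · have h := codedNode_prefix_append hT hg z (l.take (l.length - m)) (l.drop (l.length - m))
    rwa [List.take_append_drop] at h
  · rw [List.length_ofFn]
    exact (hN' _ hlen.le).trans (Nat.le_succ N)

theorem codedNode_eq_and_forall_eq (hT : IsPerfectTree T) (hg : IsSplitting T g)
    {z z' x : ℕ → Bool} {l l' : List Bool} (hlen : l.length = l'.length)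
    (hl : IsInitSeg (codedNode g z l) x) (hl' : IsInitSeg (codedNode g z' l') x) :
    codedNode g z l = codedNode g z' l' ∧ ∀ i < l.length, z i = z' i := by
  induction l generalizing l' with
  | nil =>
    obtain rfl : l' = [] := List.length_eq_zero_iff.1 hlen.symm
    exact ⟨rfl, by simp⟩
  | cons c l ih =>
    cases l' with
    | nil => simp at hlen
    | cons c' l' =>
      have hlen' : l.length = l'.length := by simpa using hlen
      obtain ⟨hnode, hz⟩ := ih hlen' (hl.of_prefix (codedNode_prefix_cons hT hg z c l))
        (hl'.of_prefix (codedNode_prefix_cons hT hg z' c' l'))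
      have h₁ := (hl.of_prefix (append_prefix_codedNode_cons hT hg z c l)).eq_of_append_singleton
      have h₂ :=
        (hl'.of_prefix (append_prefix_codedNode_cons hT hg z' c' l')).eq_of_append_singleton
      rw [← hnode, ← h₁] at h₂
      have h₃ := hl.eq_of_append_singleton
      have h₄ := hl'.eq_of_append_singleton
      rw [← hnode, h₂, ← h₃] at h₄
      refine ⟨by simp only [codedNode, ← hnode, h₂, h₄], fun i hi => ?_⟩
      rcases Nat.lt_succ_iff_lt_or_eq.1 hi with hi | rfl
      · exact hz i hi
      · rw [← h₂, hlen']

theorem eq_of_mem_branches_codedTree (hT : IsPerfectTree T) (hg : IsSplitting T g)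
    {z z' x : ℕ → Bool} (hx : x ∈ branches (codedTree g z))
    (hx' : x ∈ branches (codedTree g z')) : z = z' := by
  funext n
  obtain ⟨l, hl, hlx⟩ := exists_isInitSeg_codedNode hT hg hx (n + 1)
  obtain ⟨l', hl', hlx'⟩ := exists_isInitSeg_codedNode hT hg hx' (n + 1)
  exact (codedNode_eq_and_forall_eq hT hg (hl.trans hl'.symm) hlx hlx').2 n (by omega)

end

theorem mk_nat_to_bool : #(ℕ → Bool) = Cardinal.continuum := by simp

theorem marczewski_of_mk_lt_continuum {X : Set (ℕ → Bool)} (hX : #X < Cardinal.continuum) :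
    Marczewski X := by
  intro T hT
  obtain ⟨g, hg⟩ := hT.exists_isSplitting
  by_contra! h
  have hmeet : ∀ z, ∃ x : X, (x : ℕ → Bool) ∈ branches (codedTree g z) := by
    intro z
    obtain ⟨x, hxS, hxX⟩ := h _ (isPerfectTree_codedTree hT hg z) (codedTree_subset hT hg z)
    exact ⟨⟨x, hxX⟩, hxS⟩
  choose f hf using hmeet
  have hinj : Function.Injective f := fun z z' hzz' =>
    eq_of_mem_branches_codedTree hT hg (hf z) (hzz' ▸ hf z')
  have hle := Cardinal.mk_le_of_injective hinj
  rw [mk_nat_to_bool] at hle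
  exact hle.not_gt hX

/-- Every subset of `2^ω` of cardinality less than `𝔠` belongs to the Marczewski
ideal `s⁰`; consequently `non(s⁰)`, the least cardinality of a subset of `2^ω`
not in `s⁰`, equals `𝔠`. -/
theorem stmt3 :
    (∀ X : Set (ℕ → Bool), #X < Cardinal.continuum → Marczewski X) ∧
    sInf {c : Cardinal | ∃ Y : Set (ℕ → Bool), ¬ Marczewski Y ∧ c = #Y} =
      Cardinal.continuum := by
  refine ⟨fun X => marczewski_of_mk_lt_continuum, le_antisymm (csInf_le' ?_) ?_⟩
  · exact ⟨Set.univ, not_marczewski_univ, by rw [Cardinal.mk_univ, mk_nat_to_bool]⟩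
  · refine le_csInf ⟨_, Set.univ, not_marczewski_univ, rfl⟩ ?_
    rintro _ ⟨Y, hY, rfl⟩
    exact not_lt.1 fun h => hY (marczewski_of_mk_lt_continuum h)
end

section
/- SN(2^ω) = ⋂{ I_f : f ∈ ω^ω increasing }; that is, a set X ⊆ 2^ω has strong measure zero iff X ∈ I_f for every increasing f ∈ ω^ω. -/
/-- `f ≪ g`: for every `k`, `f ∘ pw_k ≤* g`, where `pw_k i = i ^ k`. -/
def LL (f g : ℕ → ℕ) : Prop :=
  ∀ k : ℕ, ∀ᶠ i in Filter.atTop, f (i ^ k) ≤ g i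

/-- The Yorioka ideal `I_f`. -/
def Yorioka (f : ℕ → ℕ) : Set (Set (ℕ → Bool)) :=
  {X | ∃ σ : ℕ → List Bool, X ⊆ limsupCyl σ ∧ LL f (fun n => (σ n).length)}

theorem IsInitSeg.take {s : List Bool} {x : ℕ → Bool} (h : IsInitSeg s x) (n : ℕ) :
    IsInitSeg (s.take n) x := by
  intro i
  have hi : (i : ℕ) < s.length := i.2.trans_le (List.length_take_le' n s)
  simpa using h ⟨i, hi⟩

theorem SMZ2.mem_yorioka {X : Set (ℕ → Bool)} (hX : SMZ2 X) {f : ℕ → ℕ} (hf : Monotone f) :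
    X ∈ Yorioka f := by
  choose σ hσ hcov using fun m => hX fun n => f (Nat.pair m n ^ Nat.pair m n)
  refine ⟨fun p => σ p.unpair.1 p.unpair.2, fun x hx m => ?_, fun k => ?_⟩
  · obtain ⟨n, hn⟩ := Set.mem_iUnion.1 (hcov m hx)
    exact ⟨Nat.pair m n, Nat.left_le_pair m n, by simpa [cyl] using hn⟩
  · filter_upwards [Filter.eventually_ge_atTop (max k 1)] with i hi
    simp only [hσ, Nat.pair_unpair]
    exact hf (Nat.pow_le_pow_right (le_of_max_le_right hi) (le_of_max_le_left hi))

theorem exists_strictMono_ge (f : ℕ → ℕ) : ∃ g : ℕ → ℕ, StrictMono g ∧ f ≤ g := by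
  refine ⟨fun n => n + ∑ j ∈ Finset.range (n + 1), f j, strictMono_nat_of_lt_succ fun n => ?_,
    fun n => ?_⟩
  · simp only [Finset.sum_range_succ _ (n + 1)]
    omega
  · simp only [Finset.sum_range_succ]
    omega

theorem smz2_of_forall_mem_yorioka {X : Set (ℕ → Bool)}
    (hX : ∀ f : ℕ → ℕ, StrictMono f → X ∈ Yorioka f) : SMZ2 X := by
  intro f
  obtain ⟨g, hg, hfg⟩ := exists_strictMono_ge f
  obtain ⟨σ, hσ, hlen⟩ := hX g hg
  obtain ⟨N, hN⟩ := Filter.eventually_atTop.1 (hlen 1)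
  refine ⟨fun n => if f n ≤ (σ n).length then (σ n).take (f n) else List.replicate (f n) false,
    fun n => ?_, fun x hx => ?_⟩
  · dsimp only
    split_ifs with h <;> simp [h]
  · obtain ⟨n, hn, hnx⟩ := hσ hx N
    have hle : f n ≤ (σ n).length := (hfg n).trans (by simpa using hN n hn)
    refine Set.mem_iUnion.2 ⟨n, ?_⟩
    simp only [if_pos hle]
    exact hnx.take (f n)

/-- `SN(2^ω) = ⋂ {I_f : f increasing}`: `X` has strong measure zero iff `X ∈ I_f`
for every increasing `f`. -/
theorem stmt12 (X : Set (ℕ → Bool)) :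
    SMZ2 X ↔ ∀ f : ℕ → ℕ, StrictMono f → X ∈ Yorioka f := by
  exact ⟨fun hX _ hf => hX.mem_yorioka hf.monotone, smz2_of_forall_mem_yorioka⟩
end

section
/- For every increasing f ∈ ω^ω, the Yorioka ideal I_f is a proper σ-ideal on 2^ω: it is closed under subsets and countable unions, contains all singletons, and 2^ω ∉ I_f. -/
theorem LL.of_pow_self {f g : ℕ → ℕ} (hf : Monotone f) (hg : ∀ n, f (n ^ n) ≤ g n) : LL f g := by
  intro k
  filter_upwards [Filter.eventually_ge_atTop (k + 1)] with i hi
  exact (hf (Nat.pow_le_pow_right (by omega) (by omega))).trans (hg i)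

theorem Yorioka.mono {f : ℕ → ℕ} {X Y : Set (ℕ → Bool)} (hYX : Y ⊆ X) (hX : X ∈ Yorioka f) :
    Y ∈ Yorioka f := by
  obtain ⟨σ, hσ, hf⟩ := hX
  exact ⟨σ, hYX.trans hσ, hf⟩

theorem Yorioka.singleton_mem {f : ℕ → ℕ} (hf : Monotone f) (x : ℕ → Bool) :
    {x} ∈ Yorioka f := by
  refine ⟨fun n => List.ofFn fun i : Fin (f (n ^ n)) => x i, ?_, LL.of_pow_self hf fun n => ?_⟩
  · rintro _ rfl m
    refine ⟨m, le_rfl, fun i => ?_⟩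
    simp
  · simp

/-- If `σ n` is longer than `n` for almost all `n`, then a diagonal sequence avoids almost all
the cylinders. -/
theorem limsupCyl_ne_univ {σ : ℕ → List Bool} (hσ : ∀ᶠ n in Filter.atTop, n < (σ n).length) :
    limsupCyl σ ≠ Set.univ := by
  intro h
  obtain ⟨N, hN⟩ := Filter.eventually_atTop.1 hσ
  have hx : (fun n => !(σ n).getD n false) ∈ limsupCyl σ := h ▸ Set.mem_univ _
  obtain ⟨n, hn, hinit⟩ := hx N
  have := hinit ⟨n, hN n hn⟩
  simp [List.getElem?_eq_getElem (hN n hn)] at this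

theorem Yorioka.univ_notMem {f : ℕ → ℕ} (hf : StrictMono f) : Set.univ ∉ Yorioka f := by
  rintro ⟨σ, hσ, hll⟩
  refine limsupCyl_ne_univ ?_ (Set.univ_subset_iff.1 hσ)
  filter_upwards [hll 2, Filter.eventually_ge_atTop 2] with n hn h2
  have := hf.le_apply (x := n ^ 2)
  nlinarith

theorem Nat.pair_le_pow_four {m n : ℕ} (hmn : m ≤ n) (hn : 2 ≤ n) : Nat.pair m n ≤ n ^ 4 := by
  have h := Nat.pair_lt_max_add_one_sq m n
  rw [max_eq_right hmn] at h
  have h2 : n + 1 ≤ n ^ 2 := by nlinarith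
  calc Nat.pair m n ≤ (n + 1) ^ 2 := h.le
    _ ≤ (n ^ 2) ^ 2 := Nat.pow_le_pow_left h2 2
    _ = n ^ 4 := by ring

theorem Yorioka.iUnion_mem {f : ℕ → ℕ} (hf : Monotone f) {A : ℕ → Set (ℕ → Bool)}
    (hA : ∀ n, A n ∈ Yorioka f) : (⋃ n, A n) ∈ Yorioka f := by
  choose σ hσ hll using hA
  have hN : ∀ m, ∃ N, m ≤ N ∧ 2 ≤ N ∧ ∀ n ≥ N, ∀ j ≤ m, f (n ^ j) ≤ (σ m n).length := by
    intro m
    have h : ∀ᶠ n in Filter.atTop, ∀ j ∈ Set.Iic m, f (n ^ j) ≤ (σ m n).length :=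
      (Filter.eventually_all_finite (Set.finite_Iic m)).2 fun j _ => hll m j
    obtain ⟨N, hN⟩ := Filter.eventually_atTop.1 h
    exact ⟨max N (max m 2), by omega, by omega, fun n hn j hj => hN n (by omega) j hj⟩
  choose N hmN h2N hlen using hN
  let τ : ℕ → List Bool := fun i =>
    if N i.unpair.1 ≤ i.unpair.2 then σ i.unpair.1 i.unpair.2
    else List.replicate (f (i ^ i)) false
  refine ⟨τ, Set.iUnion_subset fun m x hx M => ?_, fun k => ?_⟩
  · obtain ⟨n, hn, hinit⟩ := hσ m hx (max M (N m))
    refine ⟨Nat.pair m n, ((le_max_left _ _).trans hn).trans (Nat.right_le_pair m n), ?_⟩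
    simpa [τ, (le_max_right _ _).trans hn] using hinit
  · have h : ∀ᶠ n in Filter.atTop, ∀ m ∈ Set.Iio (4 * k),
        f (n ^ (4 * k)) ≤ (σ m n).length :=
      (Filter.eventually_all_finite (Set.finite_Iio _)).2 fun m _ => hll m (4 * k)
    obtain ⟨B, hB⟩ := Filter.eventually_atTop.1 h
    filter_upwards [Filter.eventually_ge_atTop ((4 * k + B + 1) ^ 2),
      LL.of_pow_self hf (fun _ => le_rfl) k] with i hi hself
    by_cases hNi : N i.unpair.1 ≤ i.unpair.2
    · simp only [τ, if_pos hNi]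
      obtain ⟨m, n, rfl⟩ : ∃ m n, i = Nat.pair m n := ⟨_, _, (Nat.pair_unpair i).symm⟩
      simp only [Nat.unpair_pair] at hNi ⊢
      have hpair : f (Nat.pair m n ^ k) ≤ f (n ^ (4 * k)) := by
        rw [pow_mul]
        exact hf (Nat.pow_le_pow_left
          (Nat.pair_le_pow_four ((hmN m).trans hNi) ((h2N m).trans hNi)) k)
      refine hpair.trans ?_
      rcases lt_or_ge m (4 * k) with hm | hm
      · refine hB n ?_ m hm
        by_contra! hnB
        have h1 := Nat.pair_lt_max_add_one_sq m n
        have h3 : (max m n + 1) ^ 2 ≤ (4 * k + B + 1) ^ 2 := Nat.pow_le_pow_left (by omega) 2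
        omega
      · exact hlen m n hNi (4 * k) hm
    · simpa [τ, if_neg hNi] using hself

/-- For every increasing `f`, the Yorioka ideal `I_f` is a proper σ-ideal on `2^ω`:
closed under subsets and countable unions, contains all singletons, and `2^ω ∉ I_f`. -/
theorem stmt13 (f : ℕ → ℕ) (hf : StrictMono f) :
    (∀ X Y : Set (ℕ → Bool), Y ⊆ X → X ∈ Yorioka f → Y ∈ Yorioka f) ∧
    (∀ A : ℕ → Set (ℕ → Bool), (∀ n, A n ∈ Yorioka f) → (⋃ n, A n) ∈ Yorioka f) ∧
    (∀ x : ℕ → Bool, {x} ∈ Yorioka f) ∧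
    Set.univ ∉ Yorioka f := by
  exact ⟨fun _ _ => Yorioka.mono, fun _ => Yorioka.iUnion_mem hf.monotone,
    Yorioka.singleton_mem hf.monotone, Yorioka.univ_notMem hf⟩
end

section
/- cov(M) ≤ non(SN(ℝ)) ≤ non(N): the covering number of the meager ideal on ℝ is at most the uniformity of the strong measure zero ideal on ℝ, which is at most the uniformity of the Lebesgue null ideal on ℝ. -/
open Cardinal

/-- `X ⊆ ℝ` has strong measure zero: for every sequence `ε` of positive reals there is
a sequence of intervals, the `n`-th of length at most `ε n`, covering `X`. -/
def SMZReal (X : Set ℝ) : Prop :=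
  ∀ ε : ℕ → ℝ, (∀ n, 0 < ε n) →
    ∃ a b : ℕ → ℝ, (∀ n, b n - a n ≤ ε n) ∧ X ⊆ ⋃ n, Set.Icc (a n) (b n)

/-- The ideal of strong measure zero subsets of `ℝ`. -/
def SNReal : Set (Set ℝ) := {X | SMZReal X}

/-- The ideal of Lebesgue null subsets of `ℝ`. -/
def NullIdeal : Set (Set ℝ) := {A | MeasureTheory.volume A = 0}

/-- The ideal of meager subsets of `ℝ`. -/
def MeagerIdeal : Set (Set ℝ) := {A | IsMeagre A}

/-- The covering number of a family of sets. -/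
noncomputable def covOf {α : Type*} (I : Set (Set α)) : Cardinal :=
  sInf {c | ∃ C : Set (Set α), C ⊆ I ∧ ⋃₀ C = Set.univ ∧ c = #C}

/-- The uniformity of a family of sets. -/
noncomputable def nonOf {α : Type*} (I : Set (Set α)) : Cardinal :=
  sInf {c | ∃ Y : Set α, Y ∉ I ∧ c = #Y}

/-- Strong measure zero sets are Lebesgue null. -/
theorem SMZReal.volume_eq_zero {X : Set ℝ} (hX : SMZReal X) : MeasureTheory.volume X = 0 := by
  refine nonpos_iff_eq_zero.mp (le_of_forall_pos_le_add fun δ hδ => ?_)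
  obtain ⟨ε, hε, hsum⟩ := ENNReal.exists_pos_sum_of_countable hδ.ne' ℕ
  obtain ⟨a, b, hab, hcov⟩ := hX (fun n => ε n) fun n => hε n
  calc MeasureTheory.volume X
      ≤ MeasureTheory.volume (⋃ n, Set.Icc (a n) (b n)) := MeasureTheory.measure_mono hcov
    _ ≤ ∑' n, MeasureTheory.volume (Set.Icc (a n) (b n)) := MeasureTheory.measure_iUnion_le _
    _ ≤ ∑' n, (ε n : ENNReal) := by
        refine ENNReal.tsum_le_tsum fun n => ?_
        rw [Real.volume_Icc, ENNReal.ofReal_le_iff_le_toReal ENNReal.coe_ne_top]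
        exact hab n
    _ ≤ 0 + δ := by simpa using hsum.le

/-- There is a sequence of continuous functions such that, whatever the positive tolerances, a
generic point `x` has `f n x` within the `n`-th tolerance of a given `y` for some `n`. -/
theorem exists_seq_generic_approx :
    ∃ f : ℕ → ℝ → ℝ, ∀ ε : ℕ → ℝ, (∀ n, 0 < ε n) →
      ∀ y, IsMeagre {x | ∀ n, ε n ≤ |f n x - y|} := by
  obtain ⟨e, he⟩ := exists_surjective_nat (ℕ × ℚ)
  refine ⟨fun n x => (e n).1 * (x - (e n).2), fun ε hε y => ?_⟩
  have hcompl : {x : ℝ | ∀ n, ε n ≤ |(e n).1 * (x - (e n).2) - y|}ᶜ =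
      ⋃ n, {x : ℝ | |(e n).1 * (x - (e n).2) - y| < ε n} := by
    ext x
    simp
  rw [IsMeagre, hcompl]
  refine residual_of_dense_open
    (isOpen_iUnion fun n => isOpen_lt (by fun_prop) continuous_const) ?_
  refine Metric.dense_iff.mpr fun z r hr => ?_
  obtain ⟨q, hzq, hqr⟩ := exists_rat_btwn (show z < z + r / 2 by linarith)
  obtain ⟨m, hm⟩ := exists_nat_gt (|y| / (r / 2))
  have hm0 : (0 : ℝ) < m := lt_of_le_of_lt (by positivity) hm
  obtain ⟨n, hn⟩ := he (m, q)
  refine ⟨q + y / m, ?_, Set.mem_iUnion.mpr ⟨n, ?_⟩⟩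
  · have hy : |y / m| < r / 2 := by
      rw [abs_div, abs_of_pos hm0, div_lt_iff₀ hm0]
      rwa [div_lt_iff₀ (by positivity), mul_comm] at hm
    rw [Metric.mem_ball, Real.dist_eq, abs_lt]
    rw [abs_lt] at hy
    constructor <;> linarith
  · have hval : (m : ℝ) * (q + y / m - q) - y = 0 := by
      field_simp
      ring
    simp only [Set.mem_ofPred_eq, hn, hval, abs_zero]
    exact hε n

/-- A set that is not of strong measure zero yields a meagre cover of `ℝ` of at most its size. -/
theorem covOf_meagerIdeal_le_mk {Y : Set ℝ} (hY : ¬ SMZReal Y) : covOf MeagerIdeal ≤ #Y := by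
  rw [SMZReal] at hY
  push Not at hY
  obtain ⟨ε, hε, hY⟩ := hY
  obtain ⟨f, hf⟩ := exists_seq_generic_approx
  let A : ℝ → Set ℝ := fun y => {x | ∀ n, ε n / 2 ≤ |f n x - y|}
  refine (csInf_le' ⟨A '' Y, ?_, ?_, rfl⟩ : covOf MeagerIdeal ≤ #(A '' Y)).trans mk_image_le
  · rintro _ ⟨y, -, rfl⟩
    exact hf _ (fun n => half_pos (hε n)) y
  · refine Set.eq_univ_of_forall fun x => ?_
    by_contra hx
    refine hY (fun n => f n x - ε n / 2) (fun n => f n x + ε n / 2)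
      (fun n => by linarith) fun y hy => ?_
    have hxy : x ∉ A y := fun h => hx ⟨A y, ⟨y, hy, rfl⟩, h⟩
    simp only [A, Set.mem_ofPred_eq, not_forall, not_le] at hxy
    obtain ⟨n, hn⟩ := hxy
    rw [abs_lt] at hn
    exact Set.mem_iUnion.mpr ⟨n, by constructor <;> linarith⟩

/-- The uniformity is monotone on ideals that omit some set. -/
theorem nonOf_mono {α : Type*} {I J : Set (Set α)} (h : I ⊆ J) (hJ : ∃ Y, Y ∉ J) :
    nonOf I ≤ nonOf J := by
  obtain ⟨Y₀, hY₀⟩ := hJ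
  refine le_csInf ⟨_, Y₀, hY₀, rfl⟩ ?_
  rintro _ ⟨Y, hY, rfl⟩
  exact csInf_le' ⟨Y, fun hI => hY (h hI), rfl⟩

/-- `cov(M) ≤ non(SN(ℝ)) ≤ non(N)`. -/
theorem stmt16 :
    covOf MeagerIdeal ≤ nonOf SNReal ∧ nonOf SNReal ≤ nonOf NullIdeal := by
  have hsub : SNReal ⊆ NullIdeal := fun X hX => SMZReal.volume_eq_zero hX
  have huniv : Set.univ ∉ NullIdeal := by simp [NullIdeal]
  refine ⟨le_csInf ⟨_, Set.univ, fun h => huniv (hsub h), rfl⟩ ?_, nonOf_mono hsub ⟨_, huniv⟩⟩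
  rintro _ ⟨Y, hY, rfl⟩
  exact covOf_meagerIdeal_le_mk hY
end

section
/- add(M) = min{𝔟, non(SN(ℝ))}: the additivity of the meager ideal on ℝ equals the minimum of the bounding number and the uniformity of the strong measure zero ideal on ℝ. -/
open Cardinal

/-- The bounding number `𝔟`. -/
noncomputable def bNumber : Cardinal :=
  sInf {c | ∃ B : Set (ℕ → ℕ), (¬ ∃ g : ℕ → ℕ, ∀ f ∈ B, LeStar f g) ∧ c = #B}

/-- The additivity of a family of sets. -/
noncomputable def addOf {α : Type*} (I : Set (Set α)) : Cardinal :=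
  sInf {c | ∃ A : Set (Set α), A ⊆ I ∧ ⋃₀ A ∉ I ∧ c = #A}

theorem addOf_le_mk {α : Type*} {I A : Set (Set α)} (hA : A ⊆ I) (hU : ⋃₀ A ∉ I) :
    addOf I ≤ #A :=
  csInf_le' ⟨A, hA, hU, rfl⟩

theorem nonOf_le_mk {α : Type*} {I : Set (Set α)} {Y : Set α} (hY : Y ∉ I) : nonOf I ≤ #Y :=
  csInf_le' ⟨Y, hY, rfl⟩

theorem exists_smul_sin_eq (x₀ y : ℝ) {δ : ℝ} (hδ : 0 < δ) :
    ∃ (n : ℕ) (x : ℝ), |x - x₀| < δ ∧ n * Real.sin (n * x) = y := by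
  obtain ⟨n, hn⟩ := exists_nat_gt (|y| + 2 * Real.pi / δ)
  have hπ := Real.pi_pos
  have h₁ : 0 < 2 * Real.pi / δ := by positivity
  have hy : |y| < n := by linarith
  have hn0 : (0 : ℝ) < n := (abs_nonneg y).trans_lt hy
  have hnδ : 2 * Real.pi / n < δ := by
    have : 2 * Real.pi / δ < n := by linarith [abs_nonneg y]
    rw [div_lt_iff₀ hδ] at this
    rw [div_lt_iff₀ hn0]
    linarith
  obtain ⟨h₂, h₃⟩ := abs_lt.mp hy
  set k : ℤ := ⌊(n * x₀ - Real.arcsin (y / n)) / (2 * Real.pi)⌋ with hk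
  have hk₁ := Int.floor_le ((n * x₀ - Real.arcsin (y / n)) / (2 * Real.pi))
  have hk₂ := Int.lt_floor_add_one ((n * x₀ - Real.arcsin (y / n)) / (2 * Real.pi))
  rw [← hk, le_div_iff₀ (by positivity)] at hk₁
  rw [← hk, div_lt_iff₀ (by positivity)] at hk₂
  refine ⟨n, (Real.arcsin (y / n) + k * (2 * Real.pi)) / n, ?_, ?_⟩
  · refine lt_of_le_of_lt ?_ hnδ
    have : (Real.arcsin (y / n) + k * (2 * Real.pi)) / n - x₀ =
        (Real.arcsin (y / n) + k * (2 * Real.pi) - n * x₀) / n := by field_simp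
    rw [this, abs_div, abs_of_pos hn0]
    gcongr
    rw [abs_le]
    constructor <;> linarith
  · rw [mul_div_cancel₀ _ hn0.ne', Real.sin_add_int_mul_two_pi, Real.sin_arcsin]
    · field_simp
    · rw [le_div_iff₀ hn0]; linarith
    · rw [div_le_iff₀ hn0]; linarith

theorem addOf_meagerIdeal_le_mk_of_not_smzReal {Y : Set ℝ} (hY : ¬ SMZReal Y) :
    addOf MeagerIdeal ≤ #Y := by
  unfold SMZReal at hY
  push Not at hY
  obtain ⟨ε, hε, hY⟩ := hY
  let G : ℝ → Set ℝ := fun y => {x | ∃ n : ℕ, |n * Real.sin (n * x) - y| < ε n / 2}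
  refine (addOf_le_mk (A := (fun y => (G y)ᶜ) '' Y) ?_ ?_).trans mk_image_le
  · rintro _ ⟨y, -, rfl⟩
    change (G y)ᶜᶜ ∈ residual ℝ
    rw [compl_compl]
    refine residual_of_dense_open ?_ ?_
    · simp only [G, Set.ofPred_exists]
      exact isOpen_iUnion fun n => isOpen_lt (by fun_prop) continuous_const
    · rw [Metric.dense_iff]
      intro x₀ δ hδ
      obtain ⟨n, x, hx, hxy⟩ := exists_smul_sin_eq x₀ y hδ
      refine ⟨x, by simpa [Real.dist_eq] using hx, n, ?_⟩
      simpa [hxy] using hε n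
  · intro h
    obtain ⟨x, hx⟩ := (dense_of_mem_residual (X := ℝ) h).nonempty
    refine hY (fun n => n * Real.sin (n * x) - ε n / 2) (fun n => n * Real.sin (n * x) + ε n / 2)
      (fun n => by linarith) fun y hy => ?_
    have hxy : x ∈ G y := by
      by_contra hxy
      exact hx ⟨_, ⟨y, hy, rfl⟩, hxy⟩
    obtain ⟨n, hn⟩ := hxy
    rw [abs_lt] at hn
    exact Set.mem_iUnion.mpr ⟨n, by constructor <;> linarith⟩

theorem not_smzReal_univ : ¬ SMZReal Set.univ := by
  intro h
  obtain ⟨a, b, hab, hcov⟩ := h (fun n => 2⁻¹ ^ n) (fun n => by positivity)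
  have h₁ : MeasureTheory.volume (Set.univ : Set ℝ) ≤ ∑' n : ℕ, (2⁻¹ : ENNReal) ^ n := by
    refine (MeasureTheory.measure_mono hcov).trans
      ((MeasureTheory.measure_iUnion_le _).trans (ENNReal.tsum_le_tsum fun n => ?_))
    rw [Real.volume_Icc]
    refine (ENNReal.ofReal_le_ofReal (hab n)).trans_eq ?_
    rw [ENNReal.ofReal_pow (by norm_num), ENNReal.ofReal_inv_of_pos (by norm_num)]
    simp
  rw [ENNReal.tsum_geometric, Real.volume_univ, ENNReal.one_sub_inv_two, inv_inv] at h₁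
  exact absurd h₁ (by simp)

theorem addOf_meagerIdeal_le_nonOf_SNReal : addOf MeagerIdeal ≤ nonOf SNReal := by
  refine le_csInf ⟨_, Set.univ, not_smzReal_univ, rfl⟩ ?_
  rintro _ ⟨Y, hY, rfl⟩
  exact addOf_meagerIdeal_le_mk_of_not_smzReal hY

theorem smzReal_of_mk_lt {X : Set ℝ} (hX : #X < nonOf SNReal) : SMZReal X := by
  by_contra h
  exact (nonOf_le_mk h).not_gt hX

theorem exists_leStar_of_mk_lt {ι : Type} (hι : #ι < bNumber) (F : ι → ℕ → ℕ) :
    ∃ g, ∀ i, LeStar (F i) g := by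
  by_contra h
  have : ¬ ∃ g : ℕ → ℕ, ∀ f ∈ Set.range F, LeStar f g := by simpa using h
  have hle : bNumber ≤ #(Set.range F) := csInf_le' ⟨_, this, rfl⟩
  exact (hle.trans mk_range_le).not_gt hι

theorem exists_dist_le_imp_cantorSetHomeomorphNatToBool_eq (n : ℕ) :
    ∃ ε > 0, ∀ s t : cantorSet, dist s t ≤ ε →
      cantorSetHomeomorphNatToBool s n = cantorSetHomeomorphNatToBool t n := by
  have : CompactSpace cantorSet := isCompact_iff_compactSpace.mp isCompact_cantorSet
  have hf : Continuous fun s : cantorSet => cantorSetHomeomorphNatToBool s n := by fun_prop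
  have hopen : IsOpen {p : cantorSet × cantorSet |
      cantorSetHomeomorphNatToBool p.1 n = cantorSetHomeomorphNatToBool p.2 n} := by
    have : Continuous fun p : cantorSet × cantorSet =>
      (cantorSetHomeomorphNatToBool p.1 n, cantorSetHomeomorphNatToBool p.2 n) := by fun_prop
    exact (isOpen_discrete {q : Bool × Bool | q.1 = q.2}).preimage this
  have hmem : {p : cantorSet × cantorSet |
      cantorSetHomeomorphNatToBool p.1 n = cantorSetHomeomorphNatToBool p.2 n} ∈
      uniformity cantorSet := by
    rw [← nhdsSet_diagonal_eq_uniformity]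
    refine hopen.mem_nhdsSet.mpr ?_
    rintro ⟨s, t⟩ (rfl : s = t)
    rfl
  obtain ⟨ε, hε, h⟩ := Metric.mem_uniformity_dist.mp hmem
  exact ⟨ε / 2, by positivity, fun s t hst => h (by linarith)⟩

theorem exists_map_pi_real_separating (F : ℕ → Type) [∀ k, Finite (F k)] :
    ∃ c : (∀ k, F k) → ℝ, ∀ k, ∃ ε > 0, ∀ u v, |c u - c v| ≤ ε → u k = v k := by
  classical
  have e : ∀ k, F k ≃ Fin (Nat.card (F k)) := fun k => Finite.equivFin (F k)
  choose ε hε hsep using exists_dist_le_imp_cantorSetHomeomorphNatToBool_eq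
  let bits : (∀ k, F k) → ℕ → Bool := fun u n =>
    decide ((e n.unpair.1 (u n.unpair.1) : ℕ) = n.unpair.2)
  have hbits : ∀ u k i, bits u (Nat.pair k i) = decide ((e k (u k) : ℕ) = i) := fun u k i => by
    simp only [bits]
    rw [Nat.unpair_pair]
  refine ⟨fun u => cantorSetHomeomorphNatToBool.symm (bits u), fun k => ?_⟩
  obtain ⟨δ, hδ, hle⟩ : ∃ δ > 0, ∀ i < Nat.card (F k), δ ≤ ε (Nat.pair k i) := by
    induction Nat.card (F k) with
    | zero => exact ⟨1, one_pos, by simp⟩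
    | succ m ih =>
      obtain ⟨δ, hδ, hle⟩ := ih
      refine ⟨min δ (ε (Nat.pair k m)), lt_min hδ (hε _), fun i hi => ?_⟩
      obtain hi | rfl := Nat.lt_succ_iff_lt_or_eq.mp hi
      · exact (min_le_left _ _).trans (hle i hi)
      · exact min_le_right _ _
  refine ⟨δ, hδ, fun u v huv => ?_⟩
  have h := hsep (Nat.pair k (e k (u k))) (cantorSetHomeomorphNatToBool.symm (bits u))
    (cantorSetHomeomorphNatToBool.symm (bits v)) (huv.trans (hle _ (e k (u k)).2))
  simp only [Homeomorph.apply_symm_apply, hbits] at h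
  have h' : (e k (v k) : ℕ) = e k (u k) := by simpa using h
  exact ((e k).injective (Fin.ext h')).symm

theorem exists_frequently_eq_of_mk_lt {ι : Type} (hι : #ι < nonOf SNReal) (F : ℕ → Type)
    [∀ k, Finite (F k)] [∀ k, Nonempty (F k)] (h : ι → ∀ k, F k) :
    ∃ y : ∀ k, F k, ∀ i N, ∃ k ≥ N, y k = h i k := by
  obtain ⟨c, hc⟩ := exists_map_pi_real_separating F
  choose ε hε hsep using hc
  have hX : SMZReal (Set.range fun i => c (h i)) := smzReal_of_mk_lt (mk_range_le.trans_lt hι)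
  choose a b hab hcov using fun N => hX (fun n => ε (Nat.pair N n)) fun n => hε _
  have hy : ∀ k, ∃ z : F k, ∀ i,
      c (h i) ∈ Set.Icc (a k.unpair.1 k.unpair.2) (b k.unpair.1 k.unpair.2) → z = h i k := by
    intro k
    by_cases hk : ∃ i, c (h i) ∈ Set.Icc (a k.unpair.1 k.unpair.2) (b k.unpair.1 k.unpair.2)
    · obtain ⟨i, hi⟩ := hk
      refine ⟨h i k, fun j hj => hsep k _ _ ?_⟩
      have := hab k.unpair.1 k.unpair.2
      simp only [Nat.pair_unpair] at this
      rw [abs_le]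
      constructor <;> linarith [hi.1, hi.2, hj.1, hj.2]
    · exact ⟨Classical.arbitrary _, fun i hi => absurd ⟨i, hi⟩ hk⟩
  choose y hy using hy
  refine ⟨y, fun i N => ?_⟩
  obtain ⟨n, hn⟩ := Set.mem_iUnion.mp (hcov N ⟨i, rfl⟩)
  exact ⟨Nat.pair N n, Nat.left_le_pair N n, hy _ i (by simpa using hn)⟩

theorem IsMeagre.exists_antitone_isOpen_dense {X : Type*} [TopologicalSpace X] [BaireSpace X]
    {A : Set X} (hA : IsMeagre A) :
    ∃ U : ℕ → Set X, Antitone U ∧ (∀ n, IsOpen (U n)) ∧ (∀ n, Dense (U n)) ∧ ⋂ n, U n ⊆ Aᶜ := by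
  obtain ⟨S, hSo, hSd, hSc, hSA⟩ := mem_residual_iff.mp hA
  obtain ⟨V, hV⟩ := (hSc.insert Set.univ).exists_eq_range (Set.insert_nonempty _ _)
  have hVS : ∀ n, V n ∈ insert Set.univ S := fun n => hV ▸ Set.mem_range_self n
  have hVo : ∀ n, IsOpen (V n) := fun n => by
    obtain h | h := hVS n
    · exact h ▸ isOpen_univ
    · exact hSo _ h
  have hVd : ∀ n, Dense (V n) := fun n => by
    obtain h | h := hVS n
    · exact h ▸ dense_univ
    · exact hSd _ h
  refine ⟨fun n => ⋂ i ∈ Set.Iic n, V i, fun m n hmn => ?_, fun n => ?_, fun n => ?_, ?_⟩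
  · exact Set.biInter_subset_biInter_left (Set.Iic_subset_Iic.mpr hmn)
  · exact (Set.finite_Iic n).isOpen_biInter fun i _ => hVo i
  · exact dense_biInter_of_isOpen (fun i _ => hVo i) (Set.to_countable _) fun i _ => hVd i
  · refine fun x hx => hSA fun s hs => ?_
    obtain ⟨n, rfl⟩ : s ∈ Set.range V := hV ▸ Set.mem_insert_of_mem _ hs
    exact Set.mem_iInter₂.mp (Set.mem_iInter.mp hx n) n Set.self_mem_Iic

theorem exists_seq_isOpen_nonempty_forall_exists_subset (X : Type*) [TopologicalSpace X]
    [SecondCountableTopology X] [Nonempty X] :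
    ∃ O : ℕ → Set X, (∀ n, IsOpen (O n)) ∧ (∀ n, (O n).Nonempty) ∧
      ∀ V : Set X, IsOpen V → V.Nonempty → ∀ N, ∃ n ≥ N, O n ⊆ V := by
  have hb := TopologicalSpace.isBasis_countableBasis X
  have hne : (TopologicalSpace.countableBasis X).Nonempty := by
    obtain ⟨s, hs, -⟩ := hb.exists_subset_of_mem_open (Set.mem_univ (Classical.arbitrary X))
      isOpen_univ
    exact ⟨s, hs⟩
  obtain ⟨O, hO⟩ := (TopologicalSpace.countable_countableBasis X).exists_eq_range hne
  have hmem : ∀ n, O n ∈ TopologicalSpace.countableBasis X := fun n => hO ▸ Set.mem_range_self n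
  refine ⟨fun n => O n.unpair.1, fun n => TopologicalSpace.isOpen_of_mem_countableBasis (hmem _),
    fun n => TopologicalSpace.nonempty_of_mem_countableBasis (hmem _), fun V hV ⟨x, hx⟩ N => ?_⟩
  obtain ⟨s, hs, -, hsV⟩ := hb.exists_subset_of_mem_open hx hV
  obtain ⟨j, rfl⟩ : s ∈ Set.range O := hO ▸ hs
  exact ⟨Nat.pair j N, Nat.right_le_pair j N, by simpa using hsV⟩

theorem isMeagre_iUnion_of_mk_lt {X : Type*} [TopologicalSpace X] [SecondCountableTopology X]
    [BaireSpace X] {ι : Type} {A : ι → Set X} (hA : ∀ i, IsMeagre (A i)) (hb : #ι < bNumber)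
    (hn : #ι < nonOf SNReal) : IsMeagre (⋃ i, A i) := by
  classical
  cases isEmpty_or_nonempty X
  · rw [Set.eq_empty_of_isEmpty (⋃ i, A i)]
    exact IsMeagre.empty
  choose U hUanti hUo hUd hUA using fun i => (hA i).exists_antitone_isOpen_dense
  obtain ⟨O, hOo, hOne, hO⟩ := exists_seq_isOpen_nonempty_forall_exists_subset X
  have ht : ∀ i m j, ∃ l, O l ⊆ O j ∩ U i m := fun i m j => by
    obtain ⟨l, -, hl⟩ := hO _ ((hOo j).inter (hUo i m))
      ((hUd i m).inter_open_nonempty _ (hOo j) (hOne j)) 0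
    exact ⟨l, hl⟩
  choose t ht using ht
  -- Bound the sizes of the refinements, simultaneously for all `i`.
  obtain ⟨g, hg⟩ := exists_leStar_of_mk_lt hb
    fun i m => (Finset.range m).sup fun j => t i m j + 1
  obtain ⟨M, hM_zero, hM_succ⟩ :
      ∃ M : ℕ → ℕ, M 0 = 1 ∧ ∀ k, M (k + 1) = max (M k + 1) (g (M k)) :=
    ⟨fun k => Nat.rec 1 (fun _ m => max (m + 1) (g m)) k, rfl, fun _ => rfl⟩
  have hM : StrictMono M := strictMono_nat_of_lt_succ fun k => by rw [hM_succ]; omega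
  have hM_lt : ∀ k, k < M k := fun k => by
    induction k with
    | zero => exact hM_zero ▸ one_pos
    | succ k ih => exact (Nat.succ_le_of_lt ih).trans_lt (hM k.lt_succ_self)
  have hM_pos : ∀ k, 0 < M k := fun k => (Nat.zero_le k).trans_lt (hM_lt k)
  have : ∀ k, Nonempty (Fin (M k) → Fin (M (k + 1))) := fun k => ⟨fun _ => ⟨0, hM_pos (k + 1)⟩⟩
  -- Guess the refinements infinitely often.
  obtain ⟨y, hy⟩ := exists_frequently_eq_of_mk_lt hn (fun k : ℕ => Fin (M k) → Fin (M (k + 1)))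
    fun i k j => if h : t i (M k) j < M (k + 1) then ⟨_, h⟩ else ⟨0, hM_pos (k + 1)⟩
  have hgood : ∀ i n, ∃ k ≥ n, ∀ j, O (y k j) ⊆ O j ∩ U i (M k) := fun i n => by
    obtain ⟨N, hN⟩ := Filter.eventually_atTop.mp (hg i)
    obtain ⟨k, hk, hyk⟩ := hy i (max n N)
    refine ⟨k, (le_max_left _ _).trans hk, fun j => ?_⟩
    have hlt : t i (M k) j < M (k + 1) := by
      have h₁ := hN (M k) (((le_max_right _ _).trans hk).trans (hM_lt k).le)
      have h₂ : t i (M k) j + 1 ≤ (Finset.range (M k)).sup fun j => t i (M k) j + 1 :=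
        Finset.le_sup (f := fun j => t i (M k) j + 1) (Finset.mem_range.mpr j.2)
      rw [hM_succ]
      exact (Nat.lt_of_succ_le (h₂.trans h₁)).trans_le (le_max_right _ _)
    rw [hyk]
    simpa only [hlt, dite_true] using ht i (M k) j
  choose s hs hgood using hgood
  obtain ⟨G, hG⟩ := exists_leStar_of_mk_lt hb s
  -- Follow the guesses whenever they refine.
  let e : ℕ → ℕ → ℕ := fun k j =>
    if h : j < M k then if O (y k ⟨j, h⟩) ⊆ O j then y k ⟨j, h⟩ else j else j
  have he_lt : ∀ k j, j < M k → e k j < M (k + 1) := fun k j hj => by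
    simp only [e, hj, dite_true]
    split_ifs
    · exact (y k _).2
    · exact hj.trans (hM k.lt_succ_self)
  have he_sub : ∀ k j, O (e k j) ⊆ O j := fun k j => by
    simp only [e]
    split_ifs with h₁ h₂
    exacts [h₂, le_rfl, le_rfl]
  let w : ℕ → ℕ → ℕ := fun n l => Nat.rec n (fun l j => e (n + l) j) l
  have hw_succ : ∀ n l, w n (l + 1) = e (n + l) (w n l) := fun n l => rfl
  have hw_lt : ∀ n l, w n l < M (n + l) := fun n l => by
    induction l with
    | zero => exact hM_lt n
    | succ l ih => exact he_lt _ _ ih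
  have hw_anti : ∀ n, Antitone fun l => O (w n l) := fun n =>
    antitone_nat_of_succ_le fun l => he_sub _ _
  have hW : ∀ i n, s i n ≤ G n → O (w n (G n + 1)) ⊆ U i n := fun i n hsG => by
    obtain ⟨l, hl⟩ := Nat.exists_eq_add_of_le (hs i n)
    have h₁ : O (w n (l + 1)) ⊆ U i (M (n + l)) := by
      have h := hgood i n
      rw [hl] at h
      have h₂ := h ⟨w n l, hw_lt n l⟩
      rw [hw_succ]
      simp only [e, hw_lt n l, dite_true]
      rw [if_pos (h₂.trans Set.inter_subset_left)]
      exact h₂.trans Set.inter_subset_right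
    refine (hw_anti n (by omega : l + 1 ≤ G n + 1)).trans (h₁.trans (hUanti i ?_))
    exact (Nat.le_add_right n l).trans (hM_lt _).le
  change (⋃ i, A i)ᶜ ∈ residual X
  have hres : ∀ N, ⋃ n ≥ N, O (w n (G n + 1)) ∈ residual X := fun N => by
    refine residual_of_dense_open (isOpen_biUnion fun n _ => hOo _)
      (dense_iff_inter_open.mpr fun V hV hVne => ?_)
    obtain ⟨n, hn, hnV⟩ := hO V hV hVne N
    obtain ⟨x, hx⟩ := hOne (w n (G n + 1))
    exact ⟨x, hnV (hw_anti n (Nat.zero_le (G n + 1)) hx), Set.mem_biUnion hn hx⟩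
  filter_upwards [countable_iInter_mem.mpr hres] with x hx
  rw [Set.compl_iUnion, Set.mem_iInter]
  refine fun i => hUA i (Set.mem_iInter.mpr fun n => ?_)
  obtain ⟨N, hN⟩ := Filter.eventually_atTop.mp (hG i)
  obtain ⟨m, hm, hxm⟩ := Set.mem_iUnion₂.mp (Set.mem_iInter.mp hx (max n N))
  exact hUanti i ((le_max_left _ _).trans hm) (hW i m (hN m ((le_max_right _ _).trans hm)) hxm)

theorem min_le_addOf_meagerIdeal : min bNumber (nonOf SNReal) ≤ addOf MeagerIdeal := by
  refine le_csInf ⟨_, Set.range fun x : ℝ => {x}, ?_, ?_, rfl⟩ ?_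
  · rintro _ ⟨x, rfl⟩
    exact (isClosed_singleton.isNowhereDense_iff.mpr (by simp)).isMeagre
  · have : ⋃₀ (Set.range fun x : ℝ => ({x} : Set ℝ)) = Set.univ := by ext; simp
    rw [this]
    exact not_isMeagre_of_isOpen isOpen_univ Set.univ_nonempty
  · rintro _ ⟨A, hA, hU, rfl⟩
    by_contra! h
    rw [lt_min_iff] at h
    refine hU ?_
    rw [Set.sUnion_eq_iUnion]
    exact isMeagre_iUnion_of_mk_lt (fun s : A => hA s.2) h.1 h.2

theorem exists_denseRange_disjoint_range_real :
    ∃ p q : ℕ → ℝ, DenseRange p ∧ DenseRange q ∧ ∀ i j, p i ≠ q j := by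
  let q : ℕ → ℝ := fun n => (Denumerable.ofNat ℚ n : ℝ)
  have hq : DenseRange q := Rat.denseRange_cast.comp
    (fun r => subset_closure ⟨_, Denumerable.ofNat_encode r⟩)
    Rat.continuous_coe_real
  refine ⟨fun n => q n + √2, q, ?_, hq, fun i j h => ?_⟩
  · exact (Homeomorph.addRight (√2)).surjective.denseRange.comp hq
      (Homeomorph.addRight (√2)).continuous
  · refine irrational_sqrt_two ⟨Denumerable.ofNat ℚ j - Denumerable.ofNat ℚ i, ?_⟩
    push_cast
    change q j - q i = √2
    linarith

theorem Metric.infDist_image_Iic_pos {X : Type*} [MetricSpace X] {q : ℕ → X} {x : X}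
    (hx : ∀ i, x ≠ q i) (n : ℕ) : 0 < Metric.infDist x (q '' Set.Iic n) := by
  refine (((Set.finite_Iic n).image q).isClosed.notMem_iff_infDist_pos
    (Set.nonempty_Iic.image q)).mp ?_
  rintro ⟨i, -, rfl⟩
  exact hx i rfl

theorem Metric.antitone_infDist_image_Iic {X : Type*} [MetricSpace X] (q : ℕ → X) (x : X) :
    Antitone fun n => Metric.infDist x (q '' Set.Iic n) := fun _ _ hmn =>
  Metric.infDist_le_infDist_of_subset (Set.image_mono (Set.Iic_subset_Iic.mpr hmn))
    (Set.nonempty_Iic.image q)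

theorem isMeagre_eventually_le_infDist_image_Iic {X : Type*} [MetricSpace X] [BaireSpace X]
    {q : ℕ → X} (hq : DenseRange q) {r : ℕ → ℝ} (hr : ∀ n, 0 < r n) :
    IsMeagre {x | ∀ᶠ n in Filter.atTop, r n ≤ Metric.infDist x (q '' Set.Iic n)} := by
  have hres : ∀ N, ⋃ n ≥ N, {x | Metric.infDist x (q '' Set.Iic n) < r n} ∈ residual X := by
    refine fun N => residual_of_dense_open (isOpen_biUnion fun n _ =>
      isOpen_lt (Metric.continuous_infDist_pt _) continuous_const) (hq.mono ?_)
    rintro _ ⟨i, rfl⟩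
    refine Set.mem_biUnion (le_max_left N i) ?_
    change Metric.infDist _ _ < _
    rw [Metric.infDist_zero_of_mem (Set.mem_image_of_mem q (Set.mem_Iic.mpr (le_max_right N i)))]
    exact hr _
  change _ ∈ residual X
  filter_upwards [countable_iInter_mem.mpr hres] with x hx hx'
  obtain ⟨N, hN⟩ := Filter.eventually_atTop.mp hx'
  obtain ⟨n, hn, hxn⟩ := Set.mem_iUnion₂.mp (Set.mem_iInter.mp hx N)
  exact (hN n hn).not_gt hxn

theorem exists_nat_forall_one_div_le {r : ℕ → ℝ} (hr : ∀ n, 0 < r n) (n : ℕ) :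
    ∃ m : ℕ, ∀ j ≤ n, 1 / (m + 1 : ℝ) ≤ r j := by
  induction n with
  | zero =>
    obtain ⟨m, hm⟩ := exists_nat_one_div_lt (hr 0)
    exact ⟨m, fun j hj => by rw [Nat.le_zero.mp hj]; exact hm.le⟩
  | succ n ih =>
    obtain ⟨m, hm⟩ := ih
    obtain ⟨l, hl⟩ := exists_nat_one_div_lt (hr (n + 1))
    refine ⟨max m l, fun j hj => ?_⟩
    obtain hj | rfl := Nat.le_succ_iff.mp hj
    · exact (Nat.one_div_le_one_div (le_max_left m l)).trans (hm j hj)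
    · exact (Nat.one_div_le_one_div (le_max_right m l)).trans hl.le

theorem exists_leStar_of_forall_exists_frequently_lt {p q : ℕ → ℝ} (hp : DenseRange p)
    (hpq : ∀ i j, p i ≠ q j) {v : ℕ → ℕ}
    (hv : ∀ n, ∀ j ≤ n, 1 / (v n + 1 : ℝ) ≤ Metric.infDist (p j) (q '' Set.Iic n) / 2)
    {U : ℕ → Set ℝ} (hUanti : Antitone U) (hUo : ∀ n, IsOpen (U n)) (hUd : ∀ n, Dense (U n)) :
    ∃ g : ℕ → ℕ, ∀ f : ℕ → ℕ, Monotone f → v ≤ f →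
      (∀ x ∈ ⋂ n, U n,
        ¬ ∀ᶠ n in Filter.atTop, 1 / (f n + 1 : ℝ) ≤ Metric.infDist x (q '' Set.Iic n)) →
      LeStar f g := by
  let u : ℝ → ℕ → ℝ := fun x n => Metric.infDist x (q '' Set.Iic n)
  have hu_anti : ∀ x, Antitone (u x) := Metric.antitone_infDist_image_Iic q
  have hu_pos : ∀ i n, 0 < u (p i) n := fun i n => Metric.infDist_image_Iic_pos (hpq i) n
  let δ : ℕ → ℕ → ℝ := fun i n => min (1 / (n + 1)) (u (p i) n / 2)
  have hδ : ∀ i n, 0 < δ i n := fun i n => lt_min (by positivity) (half_pos (hu_pos i n))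
  have hstep : ∀ i n, ∃ j : ℕ, ∃ r > 0, Metric.closedBall (p j) r ⊆
      Metric.closedBall (p i) (δ i n) ∩ U n := fun i n => by
    have ho : IsOpen (Metric.ball (p i) (δ i n) ∩ U n) := Metric.isOpen_ball.inter (hUo n)
    obtain ⟨j, hj⟩ := hp.exists_mem_open ho ((hUd n).inter_open_nonempty _ Metric.isOpen_ball
      ⟨p i, Metric.mem_ball_self (hδ i n)⟩)
    obtain ⟨r, hr, hrs⟩ := Metric.nhds_basis_closedBall.mem_iff.mp (ho.mem_nhds hj)
    exact ⟨j, r, hr, hrs.trans (Set.inter_subset_inter_left _ Metric.ball_subset_closedBall)⟩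
  choose J R hR hJR using hstep
  refine ⟨fun n => (Finset.range (n + 1)).sup fun i => v (J i n), fun f hf hvf hfU => ?_⟩
  by_contra hfg
  have hfreq : ∀ N, ∃ n ≥ N, ∀ i ≤ n, v (J i n) < f n := fun N => by
    obtain ⟨n, hn, hlt⟩ := Filter.frequently_atTop.mp (Filter.not_eventually.mp hfg) N
    rw [not_le] at hlt
    exact ⟨n, hn, fun i hi => (Finset.le_sup (f := fun i => v (J i n))
      (Finset.mem_range.mpr (Nat.lt_succ_of_le hi))).trans_lt hlt⟩
  -- A state `(i, n)` is a center `p i` together with the next stage `n` where `f` is large.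
  have hnext : ∀ s : ℕ × ℕ, ∃ n, s.2 < n ∧ J s.1 s.2 ≤ n ∧ 1 / (n + 1 : ℝ) ≤ R s.1 s.2 ∧
      ∀ i ≤ n, v (J i n) < f n := fun s => by
    obtain ⟨m, hm⟩ := exists_nat_one_div_lt (hR s.1 s.2)
    obtain ⟨n, hn, h⟩ := hfreq (max (max (s.2 + 1) (J s.1 s.2)) m)
    simp only [ge_iff_le, max_le_iff] at hn
    exact ⟨n, hn.1.1, hn.1.2, (Nat.one_div_le_one_div hn.2).trans hm.le, h⟩
  choose next hnext_gt hnext_J hnext_R hnext_f using hnext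
  obtain ⟨n₀, -, hn₀⟩ := hfreq 0
  let S : ℕ → ℕ × ℕ := fun k => Nat.rec (0, n₀) (fun _ s => (J s.1 s.2, next s)) k
  let i : ℕ → ℕ := fun k => (S k).1
  let n : ℕ → ℕ := fun k => (S k).2
  have hi_succ : ∀ k, i (k + 1) = J (i k) (n k) := fun k => rfl
  have hn : StrictMono n := strictMono_nat_of_lt_succ fun k => hnext_gt (S k)
  have hin : ∀ k, i k ≤ n k := fun k => by
    cases k with
    | zero => exact Nat.zero_le _
    | succ k => exact hnext_J (S k)
  have hfn : ∀ k, v (i (k + 1)) < f (n k) := fun k => by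
    have : ∀ j ≤ n k, v (J j (n k)) < f (n k) := by
      cases k with
      | zero => exact hn₀
      | succ k => exact hnext_f (S k)
    exact this _ (hin k)
  let K : ℕ → Set ℝ := fun k => Metric.closedBall (p (i k)) (δ (i k) (n k))
  have hK : ∀ k, K (k + 1) ⊆ K k ∩ U (n k) := fun k => by
    refine Set.Subset.trans (Metric.closedBall_subset_closedBall ?_) (hJR (i k) (n k))
    exact (min_le_left _ _).trans (hnext_R (S k))
  obtain ⟨x, hx⟩ := IsCompact.nonempty_iInter_of_sequence_nonempty_isCompact_isClosed K
    (fun k => (hK k).trans Set.inter_subset_left)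
    (fun k => ⟨p (i k), Metric.mem_closedBall_self (hδ _ _).le⟩)
    (isCompact_closedBall _ _) fun k => Metric.isClosed_closedBall
  rw [Set.mem_iInter] at hx
  have hxu : ∀ k, ∀ m ≤ n k, i k ≤ m → 1 / (v m + 1 : ℝ) ≤ u x m := fun k m hm him => by
    have h₁ : dist x (p (i k)) ≤ u (p (i k)) (n k) / 2 := (hx k).trans (min_le_right _ _)
    have h₂ : u (p (i k)) m ≤ u x m + dist (p (i k)) x := Metric.infDist_le_infDist_add_dist
    have h₃ := hu_anti (p (i k)) hm
    have h₄ : 1 / (v m + 1 : ℝ) ≤ u (p (i k)) m / 2 := hv m (i k) him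
    rw [dist_comm] at h₂
    linarith
  refine hfU x (Set.mem_iInter.mpr fun k => hUanti (hn.id_le k) (hK k (hx (k + 1))).2) ?_
  filter_upwards [Filter.eventually_ge_atTop (n 0)] with m hm
  obtain ⟨k, hk₁, hk₂⟩ : ∃ k, n k ≤ m ∧ m < n (k + 1) := by
    have hex : ∃ k, m < n k := ⟨m + 1, (Nat.lt_succ_self m).trans_le (hn.id_le _)⟩
    obtain ⟨k, hk⟩ : ∃ k, Nat.find hex = k + 1 := Nat.exists_eq_succ_of_ne_zero fun h0 =>
      (Nat.find_spec hex).not_ge (h0 ▸ hm)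
    exact ⟨k, not_lt.mp (Nat.find_min hex (by omega)), hk ▸ Nat.find_spec hex⟩
  obtain him | him := le_total (i (k + 1)) m
  · exact (Nat.one_div_le_one_div (hvf m)).trans (hxu (k + 1) m hk₂.le him)
  · refine (Nat.one_div_le_one_div ((hfn k).le.trans (hf hk₁))).trans ?_
    exact (hxu (k + 1) _ (hin (k + 1)) le_rfl).trans (hu_anti x him)

theorem addOf_meagerIdeal_le_bNumber : addOf MeagerIdeal ≤ bNumber := by
  refine le_csInf ⟨_, Set.univ, ?_, rfl⟩ ?_
  · rintro ⟨g, hg⟩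
    obtain ⟨n, hn⟩ := (hg (fun n => g n + 1) (Set.mem_univ _)).exists
    exact (Nat.lt_succ_self _).not_ge hn
  rintro _ ⟨B, hB, rfl⟩
  obtain ⟨p, q, hp, hq, hpq⟩ := exists_denseRange_disjoint_range_real
  choose v hv using fun n => exists_nat_forall_one_div_le
    (fun j => half_pos (Metric.infDist_image_Iic_pos (hpq j) n)) n
  let T : (ℕ → ℕ) → ℕ → ℕ := fun f n => ∑ k ∈ Finset.range (n + 1), (f k + v k)
  have hT_mono : ∀ f, Monotone (T f) := fun f m n hmn =>
    Finset.sum_le_sum_of_subset (Finset.range_mono (by omega))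
  have hT_ge : ∀ f n, f n + v n ≤ T f n := fun f n =>
    Finset.single_le_sum (f := fun k => f k + v k) (fun _ _ => Nat.zero_le _)
      (Finset.self_mem_range_succ n)
  let φ : (ℕ → ℕ) → Set ℝ := fun f =>
    {x | ∀ᶠ n in Filter.atTop, 1 / (T f n + 1 : ℝ) ≤ Metric.infDist x (q '' Set.Iic n)}
  refine (addOf_le_mk (A := φ '' B) ?_ fun hA => hB ?_).trans mk_image_le
  · rintro _ ⟨f, -, rfl⟩
    exact isMeagre_eventually_le_infDist_image_Iic hq fun n => by positivity
  · obtain ⟨U, hUanti, hUo, hUd, hUA⟩ := IsMeagre.exists_antitone_isOpen_dense hA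
    obtain ⟨g, hg⟩ := exists_leStar_of_forall_exists_frequently_lt hp hpq hv hUanti hUo hUd
    refine ⟨g, fun f hf => ?_⟩
    have h := hg (T f) (hT_mono f) (fun n => (Nat.le_add_left _ _).trans (hT_ge f n))
      fun x hx hxf => hUA hx ⟨φ f, Set.mem_image_of_mem φ hf, hxf⟩
    exact h.mono fun n hn => ((Nat.le_add_right _ _).trans (hT_ge f n)).trans hn

/-- `add(M) = min{𝔟, non(SN(ℝ))}`. -/
theorem stmt17 : addOf MeagerIdeal = min bNumber (nonOf SNReal) := by
  exact le_antisymm (le_min addOf_meagerIdeal_le_bNumber addOf_meagerIdeal_le_nonOf_SNReal)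
    min_le_addOf_meagerIdeal
end

section
/- cof(SN(ℝ)) ≤ 2^𝔡: the cofinality of the strong measure zero ideal on ℝ is at most 2 to the power of the dominating number. -/
open Cardinal

/-- The dominating number `𝔡`. -/
noncomputable def dNumber : Cardinal :=
  sInf {c | ∃ D : Set (ℕ → ℕ), (∀ g : ℕ → ℕ, ∃ f ∈ D, LeStar g f) ∧ c = #D}

/-- The cofinality of a family of sets: the least cardinality of a subfamily `C ⊆ I`
such that every member of `I` is contained in some member of `C`. -/
noncomputable def cofOf {α : Type*} (I : Set (Set α)) : Cardinal :=
  sInf {c | ∃ C : Set (Set α), C ⊆ I ∧ (∀ X ∈ I, ∃ Y ∈ C, X ⊆ Y) ∧ c = #C}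

/-- The dominating number is attained by a dominating family. -/
theorem exists_dominating_card_eq_dNumber :
    ∃ D : Set (ℕ → ℕ), (∀ g : ℕ → ℕ, ∃ f ∈ D, LeStar g f) ∧ dNumber = #D :=
  csInf_mem (s := {c | ∃ D : Set (ℕ → ℕ), (∀ g : ℕ → ℕ, ∃ f ∈ D, LeStar g f) ∧ c = #D})
    ⟨_, Set.univ, fun g => ⟨g, trivial, Filter.Eventually.of_forall fun _ => le_rfl⟩, rfl⟩

/-- A dominating family is infinite. -/
theorem infinite_of_dominating {D : Set (ℕ → ℕ)}
    (hD : ∀ g : ℕ → ℕ, ∃ f ∈ D, LeStar g f) : D.Infinite := by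
  intro hfin
  obtain ⟨f, hf, hle⟩ := hD fun n => (∑ f ∈ hfin.toFinset, f n) + 1
  obtain ⟨n, hn⟩ := hle.exists
  have hsum : f n ≤ ∑ f ∈ hfin.toFinset, f n :=
    Finset.single_le_sum (f := fun f : ℕ → ℕ => f n) (fun _ _ => Nat.zero_le _)
      (hfin.mem_toFinset.2 hf)
  beta_reduce at hn
  omega

/-- Eventual domination becomes everywhere domination after taking the maximum with a constant. -/
theorem LeStar.exists_le_max {f g : ℕ → ℕ} (h : LeStar g f) :
    ∃ k : ℕ, ∀ n, g n ≤ max (f n) k := by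
  obtain ⟨N, hN⟩ := Filter.eventually_atTop.1 h
  refine ⟨∑ i ∈ Finset.range N, g i, fun n => ?_⟩
  rcases le_or_gt N n with hn | hn
  · exact le_max_of_le_left (hN n hn)
  · exact le_max_of_le_right
      (Finset.single_le_sum (fun _ _ => Nat.zero_le _) (Finset.mem_range.2 hn))

/-- Codes for families of interval covers, one for each `f ∈ D` and each constant `k`, the `n`-th
interval of which has length at most `1 / (max (f n) k + 1)`. -/
def CoverCode (D : Set (ℕ → ℕ)) : Type :=
  {σ : D × ℕ → (ℕ → ℝ) × (ℕ → ℝ) //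
    ∀ p n, (σ p).2 n - (σ p).1 n ≤ 1 / ((max (p.1.1 n) p.2 : ℕ) + 1 : ℝ)}

/-- The set of points covered by all the covers in a code. -/
def CoverCode.toSet {D : Set (ℕ → ℕ)} (σ : CoverCode D) : Set ℝ :=
  ⋂ p, ⋃ n, Set.Icc ((σ.1 p).1 n) ((σ.1 p).2 n)

theorem CoverCode.toSet_mem_SNReal {D : Set (ℕ → ℕ)}
    (hD : ∀ g : ℕ → ℕ, ∃ f ∈ D, LeStar g f) (σ : CoverCode D) : σ.toSet ∈ SNReal := by
  intro ε hε
  choose g hg using fun n => exists_nat_one_div_lt (hε n)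
  obtain ⟨f, hf, hgf⟩ := hD g
  obtain ⟨k, hk⟩ := hgf.exists_le_max
  refine ⟨(σ.1 (⟨f, hf⟩, k)).1, (σ.1 (⟨f, hf⟩, k)).2, fun n => ?_, Set.iInter_subset _ _⟩
  exact (σ.2 (⟨f, hf⟩, k) n).trans
    ((Nat.one_div_le_one_div (hk n)).trans (hg n).le)

theorem exists_subset_toSet {X : Set ℝ} (hX : X ∈ SNReal) (D : Set (ℕ → ℕ)) :
    ∃ σ : CoverCode D, X ⊆ σ.toSet := by
  choose a b hab hcov using fun p : D × ℕ =>
    hX (fun n => 1 / ((max (p.1.1 n) p.2 : ℕ) + 1 : ℝ)) fun _ => Nat.one_div_pos_of_nat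
  exact ⟨⟨fun p => (a p, b p), hab⟩, Set.subset_iInter hcov⟩

theorem mk_coverCode_le {D : Set (ℕ → ℕ)} (hD : D.Infinite) : #(CoverCode D) ≤ 2 ^ #D := by
  have hω : ℵ₀ ≤ #D := Cardinal.infinite_iff.1 hD.to_subtype
  refine (mk_subtype_le _).trans (le_of_eq ?_)
  simp only [← power_def, mk_prod, lift_id, mk_nat, mk_real,
    continuum_mul_self, continuum_power_aleph0]
  rw [← two_power_aleph0, ← power_mul, mul_comm, mul_assoc, aleph0_mul_aleph0,
    mul_aleph0_eq hω]

/-- `cof(SN(ℝ)) ≤ 2 ^ 𝔡`. -/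
theorem stmt18 : cofOf SNReal ≤ 2 ^ dNumber := by
  obtain ⟨D, hD, hcard⟩ := exists_dominating_card_eq_dNumber
  rw [hcard]
  have hcof : cofOf SNReal ≤ #(Set.range (CoverCode.toSet (D := D))) := by
    refine csInf_le' ⟨_, ?_, fun X hX => ?_, rfl⟩
    · rintro _ ⟨σ, rfl⟩
      exact σ.toSet_mem_SNReal hD
    · obtain ⟨σ, hσ⟩ := exists_subset_toSet hX D
      exact ⟨_, ⟨σ, rfl⟩, hσ⟩
  exact hcof.trans (mk_range_le.trans (mk_coverCode_le (infinite_of_dominating hD)))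
end

section
/- add(N) ≤ add(SN(ℝ)): the additivity of the Lebesgue null ideal on ℝ is at most the additivity of the strong measure zero ideal on ℝ. -/
open Cardinal

open MeasureTheory Set Filter
open scoped Pointwise Topology

lemma card_mul_measureReal_le_one_of_disjoint {Ω ι : Type*} [MeasurableSpace Ω] (μ : Measure Ω)
    [IsProbabilityMeasure μ] {G : ι → Set Ω} {p : ℝ} (hp : 0 < p)
    (hG : ∀ i, MeasurableSet (G i)) (h_one : ∀ i, μ.real (G i) = p)
    (h_two : ∀ i j, i ≠ j → μ.real (G i ∩ G j) ≤ p ^ 2)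
    {K : Set Ω} (hK : MeasurableSet K) (s : Finset ι) (hs : ∀ i ∈ s, Disjoint K (G i)) :
    s.card * p * μ.real K ≤ 1 := by
  classical
  set c : ℝ := s.card * p with hc
  have hc0 : 0 ≤ c := by positivity
  let F : Ω → ℝ := fun x => ∑ i ∈ s, ∑ j ∈ s, (G i ∩ G j).indicator 1 x
    - 2 * c * ∑ i ∈ s, (G i).indicator 1 x + c ^ 2
  have hint : ∀ {A : Set Ω}, MeasurableSet A → Integrable (A.indicator (1 : Ω → ℝ)) μ :=
    fun hA => (integrable_const (1 : ℝ)).indicator hA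
  have hF : ∀ x, F x = (∑ i ∈ s, (G i).indicator 1 x - c) ^ 2 := by
    intro x
    simp only [F, inter_indicator_one, Pi.mul_apply, ← Finset.mul_sum, ← Finset.sum_mul]
    ring
  have hI1 : Integrable (fun x => ∑ i ∈ s, ∑ j ∈ s, (G i ∩ G j).indicator (1 : Ω → ℝ) x) μ :=
    integrable_finsetSum _ fun i _ => integrable_finsetSum _ fun j _ =>
      hint ((hG i).inter (hG j))
  have hI2 : Integrable (fun x => ∑ i ∈ s, (G i).indicator (1 : Ω → ℝ) x) μ :=
    integrable_finsetSum _ fun i _ => hint (hG i)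
  have hI3 : Integrable (fun x => ∑ i ∈ s, ∑ j ∈ s, (G i ∩ G j).indicator (1 : Ω → ℝ) x
      - 2 * c * ∑ i ∈ s, (G i).indicator (1 : Ω → ℝ) x) μ := hI1.sub (hI2.const_mul _)
  have hFI : Integrable F μ := hI3.add (integrable_const _)
  have hval : ∫ x, F x ∂μ
      = ∑ i ∈ s, ∑ j ∈ s, μ.real (G i ∩ G j) - 2 * c * ∑ i ∈ s, μ.real (G i) + c ^ 2 := by
    simp only [F]
    rw [integral_add hI3 (integrable_const _),
      integral_sub hI1 (hI2.const_mul _), integral_const_mul,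
      integral_finsetSum _ fun i _ => hint (hG i),
      integral_finsetSum _ fun i _ => integrable_finsetSum _ fun j _ =>
        hint ((hG i).inter (hG j))]
    simp_rw [integral_finsetSum s fun j _ => hint ((hG _).inter (hG j)),
      integral_indicator_one ((hG _).inter (hG _)), integral_indicator_one (hG _)]
    simp
  have hup : ∑ i ∈ s, ∑ j ∈ s, μ.real (G i ∩ G j) ≤ c + c ^ 2 := by
    have : ∀ i ∈ s, ∑ j ∈ s, μ.real (G i ∩ G j) ≤ p + s.card * p ^ 2 := by
      intro i hi
      rw [← Finset.add_sum_erase s _ hi, inter_self, h_one]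
      gcongr
      calc _ ≤ ∑ j ∈ s.erase i, p ^ 2 :=
            Finset.sum_le_sum fun j hj => h_two i j (Finset.ne_of_mem_erase hj).symm
        _ ≤ ∑ j ∈ s, p ^ 2 := Finset.sum_le_sum_of_subset_of_nonneg (Finset.erase_subset _ _)
            fun _ _ _ => by positivity
        _ = _ := by simp
    refine (Finset.sum_le_sum this).trans (le_of_eq ?_)
    simp [hc]; ring
  have hlow : c ^ 2 * μ.real K ≤ ∫ x, F x ∂μ := by
    have : ∫ x, K.indicator (fun _ => c ^ 2) x ∂μ = c ^ 2 * μ.real K := by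
      rw [integral_indicator_const _ hK, smul_eq_mul, mul_comm]
    rw [← this]
    refine integral_mono ((integrable_const _).indicator hK) hFI fun x => ?_
    by_cases hx : x ∈ K
    · have h0 : ∑ i ∈ s, (G i).indicator (1 : Ω → ℝ) x = 0 :=
        Finset.sum_eq_zero fun i hi => indicator_of_notMem (disjoint_left.1 (hs i hi) hx) _
      simp [hF, hx, h0]
    · simp only [indicator_of_notMem hx, hF]
      positivity
  have hsum : ∑ i ∈ s, μ.real (G i) = c := by simp [h_one, hc]
  rw [hval, hsum] at hlow
  rcases hc0.eq_or_lt with h | h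
  · simp [← h]
  · have : c * (c * μ.real K) ≤ c * 1 := by nlinarith
    exact le_of_mul_le_mul_left this h

namespace UnitAddCircle

/-- The points of the circle whose multiple by `M ^ i` lies in the arc of length `1 / M`
centred at `0`. -/
def lacunaryArc (M i : ℕ) : Set UnitAddCircle :=
  (fun y => ((M ^ i : ℕ) : ℤ) • y) ⁻¹' Metric.ball 0 (1 / (2 * (M : ℝ)))

lemma isOpen_lacunaryArc (M i : ℕ) : IsOpen (lacunaryArc M i) :=
  Metric.isOpen_ball.preimage (continuous_zsmul _)

variable {M : ℕ}

lemma measurePreserving_pow_zsmul (hM : 0 < M) (i : ℕ) :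
    MeasurePreserving (fun y : UnitAddCircle => ((M ^ i : ℕ) : ℤ) • y) volume volume :=
  Measure.measurePreserving_zsmul volume (by positivity)

lemma volume_lacunaryArc (hM : 0 < M) (i : ℕ) :
    volume (lacunaryArc M i) = ENNReal.ofReal (1 / M) := by
  have h1 : (1 : ℝ) ≤ M := by exact_mod_cast hM
  rw [lacunaryArc, (measurePreserving_pow_zsmul hM i).measure_preimage
    Metric.isOpen_ball.measurableSet.nullMeasurableSet,
    ← measure_congr AddCircle.closedBall_ae_eq_ball, AddCircle.volume_closedBall]
  congr 1
  rw [min_eq_right]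
  · field_simp
  · rw [← mul_div_assoc, mul_one, div_le_one (by positivity)]
    linarith

lemma vadd_lacunaryArc_succ (k : ℕ) {u : UnitAddCircle} (hu : M • u = 0) :
    u +ᵥ lacunaryArc M (k + 1) = lacunaryArc M (k + 1) := by
  have hu0 : ((M ^ (k + 1) : ℕ) : ℤ) • u = 0 := by
    rw [natCast_zsmul, pow_succ, mul_smul, hu, smul_zero]
  ext y
  rw [Set.mem_vadd_set_iff_neg_vadd_mem]
  simp only [lacunaryArc, mem_preimage, vadd_eq_add, smul_add, smul_neg, hu0, neg_zero, zero_add]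

lemma lacunaryArc_inter (M i j : ℕ) : lacunaryArc M i ∩ lacunaryArc M (i + j)
    = (fun y => ((M ^ i : ℕ) : ℤ) • y) ⁻¹' (lacunaryArc M j ∩ lacunaryArc M 0) := by
  ext y
  simp only [lacunaryArc, mem_inter_iff, mem_preimage, smul_smul, ← Nat.cast_mul, ← pow_add,
    add_comm i, pow_zero, Nat.cast_one, one_smul]
  tauto

lemma lacunaryArc_zero (M : ℕ) : lacunaryArc M 0 = Metric.ball 0 (1 / (2 * (M : ℝ))) := by
  simp [lacunaryArc]

lemma volume_lacunaryArc_inter (hM : 0 < M) (i k : ℕ) :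
    volume (lacunaryArc M i ∩ lacunaryArc M (i + (k + 1))) = ENNReal.ofReal ((1 / M) ^ 2) := by
  rw [lacunaryArc_inter, (measurePreserving_pow_zsmul hM i).measure_preimage
    ((isOpen_lacunaryArc _ _).inter (isOpen_lacunaryArc _ _)).measurableSet.nullMeasurableSet]
  let u : UnitAddCircle := ((1 / M : ℝ) : UnitAddCircle)
  have hu : addOrderOf u = M := AddCircle.addOrderOf_period_div (p := (1 : ℝ)) hM
  have hu0 : M • u = 0 := by
    conv_lhs => rw [← hu]
    exact addOrderOf_nsmul_eq_zero u
  have h := AddCircle.volume_of_add_preimage_eq (lacunaryArc M (k + 1)) (lacunaryArc M 0) u 0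
    (addOrderOf_pos_iff.1 (hu ▸ hM)) (Filter.EventuallyEq.of_eq (vadd_lacunaryArc_succ k hu0))
    (Filter.EventuallyEq.of_eq (by rw [hu, lacunaryArc_zero]))
  rw [hu, volume_lacunaryArc hM, nsmul_eq_mul] at h
  have hM' : (M : ENNReal) ≠ 0 := by exact_mod_cast hM.ne'
  rw [← ENNReal.mul_right_inj hM' (ENNReal.natCast_ne_top M), ← h, ← ENNReal.ofReal_natCast,
    ← ENNReal.ofReal_mul (by positivity)]
  congr 1
  field_simp

end UnitAddCircle

/-- Lebesgue measure on the unit interval carries, for every `n`, an infinite sequence of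
pairwise independent open sets of measure `2⁻ⁿ`. -/
lemma exists_isOpen_pairwise_indep_unitInterval :
    ∃ G : ℕ → ℕ → Set ℝ, (∀ n i, IsOpen (G n i)) ∧
      (∀ n i, volume.restrict (Ioc (0 : ℝ) 1) (G n i) = ENNReal.ofReal ((1 / 2) ^ n)) ∧
      ∀ n i j, i ≠ j → (volume.restrict (Ioc (0 : ℝ) 1)).real (G n i ∩ G n j)
        ≤ ((1 / 2) ^ n) ^ 2 := by
  have hmk : MeasurePreserving ((↑) : ℝ → UnitAddCircle) (volume.restrict (Ioc 0 1)) := by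
    simpa using UnitAddCircle.measurePreserving_mk 0
  have hM : ∀ n : ℕ, (1 / 2 : ℝ) ^ n = 1 / ((2 ^ n : ℕ) : ℝ) := fun n => by
    rw [one_div_pow]; push_cast; rfl
  refine ⟨fun n i => (↑) ⁻¹' UnitAddCircle.lacunaryArc (2 ^ n) i,
    fun n i => (UnitAddCircle.isOpen_lacunaryArc _ i).preimage (AddCircle.continuous_mk' 1),
    fun n i => ?_, fun n i j hij => ?_⟩
  · rw [hmk.measure_preimage
      (UnitAddCircle.isOpen_lacunaryArc _ i).measurableSet.nullMeasurableSet,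
      UnitAddCircle.volume_lacunaryArc (by positivity), hM]
  · rw [← preimage_inter, measureReal_def,
      hmk.measure_preimage ((UnitAddCircle.isOpen_lacunaryArc _ i).inter
        (UnitAddCircle.isOpen_lacunaryArc _ j)).measurableSet.nullMeasurableSet]
    wlog h : i < j generalizing i j
    · rw [inter_comm]
      exact this j i hij.symm (by omega)
    · obtain ⟨k, rfl⟩ := Nat.exists_eq_add_of_lt h
      rw [add_assoc, UnitAddCircle.volume_lacunaryArc_inter (by positivity), hM,
        ENNReal.toReal_ofReal (by positivity)]

lemma sUnion_mem_of_mk_lt_addOf {α : Type*} {I : Set (Set α)} {A : Set (Set α)} (hA : A ⊆ I)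
    (h : #A < addOf I) : ⋃₀ A ∈ I := by
  by_contra hU
  exact h.not_ge (csInf_le' ⟨A, hA, hU, rfl⟩)

lemma exists_isCompact_forall_isOpen_inter_pos (μ : Measure ℝ) [IsFiniteMeasure μ] {T : Set ℝ}
    (hT : MeasurableSet T) (h : 0 < μ T) :
    ∃ K ⊆ T, IsCompact K ∧ K.Nonempty ∧
      ∀ U, IsOpen U → (K ∩ U).Nonempty → 0 < μ (K ∩ U) := by
  obtain ⟨K, hKT, hK, hpos⟩ := hT.exists_lt_isCompact h
  have hsub : (μ.restrict K).support ⊆ K :=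
    Measure.support_subset_of_isClosed hK.isClosed (self_mem_ae_restrict hK.measurableSet)
  refine ⟨(μ.restrict K).support, hsub.trans hKT,
    hK.of_isClosed_subset Measure.isClosed_support hsub,
    Measure.nonempty_support fun h0 => hpos.ne' ?_, ?_⟩
  · rw [← Measure.restrict_apply_self, h0]; rfl
  · rintro U hU ⟨x, hx, hxU⟩
    have h1 := (Measure.mem_support_iff_forall x).1 hx U (hU.mem_nhds hxU)
    rw [← measure_inter_conull (Measure.measure_compl_support (μ := μ.restrict K)),
      inter_comm] at h1
    exact h1.trans_le (Measure.restrict_apply_le _ _)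

/-- If a nonempty compact set is disjoint from the limit superior of open sets `V n`, then some
nonempty relatively open part of it misses all but finitely many of the `V n`. -/
lemma IsCompact.exists_isOpen_disjoint_of_disjoint_limsup {X : Type*} [TopologicalSpace X]
    [T2Space X] {K : Set X} (hK : IsCompact K) (hne : K.Nonempty) {V : ℕ → Set X}
    (hV : ∀ n, IsOpen (V n)) (h : ∀ x ∈ K, ¬ ∃ᶠ n in atTop, x ∈ V n) :
    ∃ U, IsOpen U ∧ (K ∩ U).Nonempty ∧ ∃ m, ∀ n ≥ m, Disjoint (K ∩ U) (V n) := by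
  have : CompactSpace K := isCompact_iff_compactSpace.1 hK
  have : Nonempty K := hne.to_subtype
  obtain ⟨m, ⟨x, hx⟩⟩ := nonempty_interior_of_iUnion_of_closed
    (f := fun m : ℕ => {x : K | ∀ n ≥ m, (x : X) ∉ V n})
    (fun m => by
      simp only [ofPred_forall]
      exact isClosed_iInter fun n => isClosed_iInter fun _ =>
        ((hV n).preimage continuous_subtype_val).isClosed_compl)
    (by
      refine eq_univ_of_forall fun x => ?_
      have := h x x.2
      simpa [not_frequently, eventually_atTop] using this)
  obtain ⟨U, hU, hUi⟩ := isOpen_induced_iff.1 (isOpen_interior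
    (s := {x : K | ∀ n ≥ m, (x : X) ∉ V n}))
  refine ⟨U, hU, ⟨x, x.2, ?_⟩, m, fun n hn => disjoint_left.2 fun y hy => ?_⟩
  · rw [← hUi] at hx; exact hx
  · have : (⟨y, hy.1⟩ : K) ∈ interior {x : K | ∀ n ≥ m, (x : X) ∉ V n} := by
      rw [← hUi]; exact hy.2
    exact interior_subset this n hn

/-- Fewer than `add(N)` functions can be localized by a single slalom of fixed width. -/
lemma exists_slalom_of_mk_lt_addOf_nullIdeal {F : Set (ℕ → ℕ)} (hF : #F < addOf NullIdeal) :
    ∃ S : ℕ → Set ℕ, (∀ n, (S n).Finite ∧ (S n).ncard ≤ (n + 1) * 4 ^ n) ∧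
      ∀ f ∈ F, ∀ᶠ n in atTop, f n ∈ S n := by
  classical
  obtain ⟨G, hGo, hG1, hG2⟩ := exists_isOpen_pairwise_indep_unitInterval
  set μ : Measure ℝ := volume.restrict (Ioc (0 : ℝ) 1) with hμ
  have : IsProbabilityMeasure μ := ⟨by simp [hμ]⟩
  let H : (ℕ → ℕ) → Set ℝ := fun f => {x | ∃ᶠ n in atTop, x ∈ G n (f n)} ∩ Ioc 0 1
  have hH : ∀ f, volume (H f) = 0 := by
    intro f
    rw [← Measure.restrict_apply' measurableSet_Ioc]
    refine measure_setOfPred_frequently_eq_zero (p := fun n x => x ∈ G n (f n)) ?_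
    have hs : Summable fun n : ℕ => ((1 / 2 : ℝ)) ^ n := summable_geometric_two
    change ∑' n, μ (G n (f n)) ≠ _
    simp_rw [hG1]
    exact hs.tsum_ofReal_ne_top
  have hnull : volume (⋃₀ (H '' F)) = 0 :=
    sUnion_mem_of_mk_lt_addOf (I := NullIdeal) (by rintro _ ⟨f, -, rfl⟩; exact hH f)
      (mk_image_le.trans_lt hF)
  obtain ⟨K, hKT, hK, hKne, hKpos⟩ := exists_isCompact_forall_isOpen_inter_pos μ
    (T := (toMeasurable volume (⋃₀ (H '' F)))ᶜ ∩ Ioc 0 1)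
    ((measurableSet_toMeasurable _ _).compl.inter measurableSet_Ioc) (by
      rw [hμ, Measure.restrict_apply' measurableSet_Ioc, inter_assoc, inter_self, inter_comm,
        measure_inter_conull (by rw [compl_compl, measure_toMeasurable, hnull])]
      simp)
  obtain ⟨b, hbc, -, hb⟩ := TopologicalSpace.exists_countable_basis ℝ
  have hbne : b.Nonempty :=
    let ⟨s, hs, _⟩ := hb.exists_subset_of_mem_open (mem_univ (0 : ℝ)) isOpen_univ
    ⟨s, hs⟩
  obtain ⟨U, rfl⟩ := hbc.exists_eq_range hbne
  let Z : ℕ → ℕ → Set ℕ := fun k n => {i | Disjoint (K ∩ U k) (G n i)}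
  have hZ : ∀ k, (K ∩ U k).Nonempty →
      ∀ᶠ n in atTop, (Z k n).Finite ∧ (Z k n).ncard ≤ 4 ^ n := by
    intro k hk
    have hUo : IsOpen (U k) := hb.isOpen (mem_range_self k)
    have hpos : 0 < μ.real (K ∩ U k) :=
      ENNReal.toReal_pos (hKpos _ hUo hk).ne' (measure_ne_top _ _)
    have hlim : Tendsto (fun n : ℕ => (2 : ℝ) ^ n) atTop atTop :=
      tendsto_pow_atTop_atTop_of_one_lt (by norm_num)
    filter_upwards [hlim.eventually_ge_atTop (μ.real (K ∩ U k))⁻¹] with n hn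
    have hcard : ∀ s : Finset ℕ, (s : Set ℕ) ⊆ Z k n → s.card ≤ 4 ^ n := by
      intro s hs
      have h1 := card_mul_measureReal_le_one_of_disjoint μ (G := G n) (p := (1 / 2) ^ n)
        (by positivity) (fun i => (hGo n i).measurableSet)
        (fun i => by rw [measureReal_def, hG1, ENNReal.toReal_ofReal (by positivity)])
        (hG2 n) (hK.measurableSet.inter hUo.measurableSet) s (fun i hi => hs hi)
      have h2 : 1 ≤ 2 ^ n * μ.real (K ∩ U k) := by
        rwa [inv_le_iff_one_le_mul₀ hpos] at hn
      have h3 : (s.card : ℝ) ≤ 4 ^ n := by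
        rw [one_div_pow] at h1
        have h4 : (4 : ℝ) ^ n = 2 ^ n * 2 ^ n := by rw [← mul_pow]; norm_num
        have h5 : (s.card : ℝ) * μ.real (K ∩ U k) ≤ 2 ^ n := by
          have : (0 : ℝ) < 2 ^ n := by positivity
          field_simp at h1
          linarith
        have h6 : (0 : ℝ) < 2 ^ n := by positivity
        calc (s.card : ℝ) = s.card * 1 := (mul_one _).symm
          _ ≤ s.card * (2 ^ n * μ.real (K ∩ U k)) := by gcongr
          _ = 2 ^ n * (s.card * μ.real (K ∩ U k)) := by ring
          _ ≤ 2 ^ n * 2 ^ n := by gcongr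
          _ = 4 ^ n := h4.symm
      exact_mod_cast h3
    have hfin : (Z k n).Finite := by
      by_contra hinf
      obtain ⟨s, hs, hs'⟩ := Set.Infinite.exists_subset_card_eq hinf (4 ^ n + 1)
      have := hcard s hs
      omega
    refine ⟨hfin, ?_⟩
    rw [ncard_eq_toFinset_card _ hfin]
    exact hcard _ (by simp)
  let good : ℕ → Finset ℕ := fun n =>
    (Finset.range (n + 1)).filter fun k => (Z k n).Finite ∧ (Z k n).ncard ≤ 4 ^ n
  refine ⟨fun n => ⋃ k ∈ good n, Z k n, fun n => ⟨?_, ?_⟩, fun f hf => ?_⟩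
  · exact (good n).finite_toSet.biUnion fun k hk => (Finset.mem_filter.1 hk).2.1
  · calc (⋃ k ∈ good n, Z k n).ncard ≤ ∑ k ∈ good n, (Z k n).ncard :=
          Finset.set_ncard_biUnion_le _ _
      _ ≤ (good n).card • 4 ^ n := Finset.sum_le_card_nsmul _ _ _ fun k hk =>
          (Finset.mem_filter.1 hk).2.2
      _ ≤ (n + 1) * 4 ^ n := by
        rw [smul_eq_mul]
        gcongr
        exact (Finset.card_filter_le _ _).trans (by simp)
  · obtain ⟨V, hVo, ⟨x, hxK, hxV⟩, m, hm⟩ := hK.exists_isOpen_disjoint_of_disjoint_limsup hKne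
      (V := fun n => G n (f n)) (fun n => hGo _ _) fun x hx hfreq =>
        (hKT hx).1 (subset_toMeasurable _ _ ⟨H f, ⟨f, hf, rfl⟩, hfreq, (hKT hx).2⟩)
    obtain ⟨_, ⟨k, rfl⟩, hxU, hUV⟩ := hb.exists_subset_of_mem_open hxV hVo
    filter_upwards [hZ k ⟨x, hxK, hxU⟩, eventually_ge_atTop m, eventually_ge_atTop k]
      with n hn hmn hkn
    refine mem_biUnion (x := k) ?_ ?_
    · exact Finset.mem_filter.2 ⟨Finset.mem_range.2 (by omega), hn⟩
    · exact (hm n hmn).mono_left (inter_subset_inter_right _ hUV)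

/-- A strong measure zero set is covered infinitely often by suitable members of prescribed grids
of closed intervals. -/
lemma SMZReal.exists_frequently_mem_Icc {X : Set ℝ} (hX : SMZReal X) {δ : ℕ → ℝ}
    (hδ : ∀ n, 0 < δ n) :
    ∃ z : ℕ → ℤ, ∀ x ∈ X, ∃ᶠ n in atTop, x ∈ Icc (z n * (δ n / 2)) (z n * (δ n / 2) + δ n) := by
  choose a b hab hcov using fun k : ℕ =>
    hX (fun m => δ (Nat.pair k m) / 2) fun m => half_pos (hδ _)
  refine ⟨fun n => ⌊a n.unpair.1 n.unpair.2 / (δ n / 2)⌋, fun x hx => ?_⟩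
  refine frequently_atTop.2 fun k => ?_
  obtain ⟨m, hm⟩ := mem_iUnion.1 (hcov k hx)
  refine ⟨Nat.pair k m, Nat.left_le_pair k m, ?_⟩
  have hd := half_pos (hδ (Nat.pair k m))
  have h1 := hab k m
  have h2 := Int.floor_le (a k m / (δ (Nat.pair k m) / 2))
  have h3 := (Int.lt_floor_add_one (a k m / (δ (Nat.pair k m) / 2))).le
  rw [le_div_iff₀ hd] at h2
  rw [div_le_iff₀ hd] at h3
  simp only [Nat.unpair_pair]
  constructor
  · exact h2.trans hm.1
  · have := hm.2
    linarith

lemma exists_pos_forall_lt_le (ε : ℕ → ℝ) (hε : ∀ n, 0 < ε n) (N : ℕ) :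
    ∃ δ > 0, ∀ j < N, δ ≤ ε j := by
  induction N with
  | zero => exact ⟨1, one_pos, by simp⟩
  | succ N ih =>
    obtain ⟨δ, h0, h⟩ := ih
    refine ⟨min δ (ε N), lt_min h0 (hε N), fun j hj => ?_⟩
    rcases Nat.lt_succ_iff_lt_or_eq.1 hj with hj | rfl
    · exact (min_le_left _ _).trans (h j hj)
    · exact min_le_right _ _

lemma Set.Finite.exists_subset_image_Iio {α : Type*} [Nonempty α] {s : Set α} (hs : s.Finite)
    {N : ℕ} (hN : s.ncard ≤ N) : ∃ e : ℕ → α, s ⊆ e '' Iio N := by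
  classical
  let E := hs.toFinset.equivFin
  have hc : hs.toFinset.card ≤ N := by rwa [← ncard_eq_toFinset_card s hs]
  refine ⟨fun j => if h : j < hs.toFinset.card then E.symm ⟨j, h⟩ else Classical.arbitrary α,
    fun x hx => ⟨E ⟨x, hs.mem_toFinset.2 hx⟩, (E _).2.trans_le hc, ?_⟩⟩
  simp

lemma sUnion_mem_SNReal_of_mk_lt {A : Set (Set ℝ)} (hA : A ⊆ SNReal)
    (h : #A < addOf NullIdeal) : ⋃₀ A ∈ SNReal := by
  intro ε hε
  choose δ hδ0 hδ using fun n : ℕ =>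
    exists_pos_forall_lt_le (fun j => ε (Nat.pair n j)) (fun j => hε _) ((n + 1) * 4 ^ n)
  have hz : ∀ X : A, ∃ z : ℕ → ℤ, ∀ x ∈ X.1, ∃ᶠ n in atTop,
      x ∈ Icc (z n * (δ n / 2)) (z n * (δ n / 2) + δ n) := fun X =>
    SMZReal.exists_frequently_mem_Icc (hA X.2) hδ0
  choose z hz using hz
  obtain ⟨S, hS, hSz⟩ := exists_slalom_of_mk_lt_addOf_nullIdeal
    (F := range fun (X : A) n => Equiv.intEquivNat (z X n)) (mk_range_le.trans_lt h)
  choose e he using fun n => (hS n).1.exists_subset_image_Iio (hS n).2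
  let c : ℕ → ℝ := fun m =>
    Equiv.intEquivNat.symm (e m.unpair.1 m.unpair.2) * (δ m.unpair.1 / 2)
  refine ⟨c, fun m => c m + min (δ m.unpair.1) (ε m), fun m => ?_, ?_⟩
  · rw [add_sub_cancel_left]; exact min_le_right _ _
  · rintro x ⟨X, hX, hx⟩
    obtain ⟨n, hxn, hn⟩ := ((hz ⟨X, hX⟩ x hx).and_eventually
      (hSz _ (mem_range_self (⟨X, hX⟩ : A)))).exists
    obtain ⟨j, hj, hje⟩ := he n hn
    refine mem_iUnion.2 ⟨Nat.pair n j, ?_⟩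
    simpa [c, Nat.unpair_pair, hje, min_eq_left (hδ n j hj)] using hxn

lemma univ_notMem_SNReal : (univ : Set ℝ) ∉ SNReal := by
  intro h
  obtain ⟨a, b, hab, hcov⟩ := h (fun n => (1 / 2) ^ n) fun n => by positivity
  have h1 : volume (univ : Set ℝ) ≤ ∑' n : ℕ, ENNReal.ofReal ((1 / 2 : ℝ) ^ n) :=
    (measure_mono hcov).trans <| (measure_iUnion_le _).trans <| ENNReal.tsum_le_tsum fun n => by
      rw [Real.volume_Icc]; exact ENNReal.ofReal_le_ofReal (hab n)
  rw [Real.volume_univ, top_le_iff] at h1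
  exact summable_geometric_two.tsum_ofReal_ne_top h1

lemma singleton_mem_SNReal (x : ℝ) : {x} ∈ SNReal := fun ε hε =>
  ⟨fun _ => x, fun _ => x, fun n => by simpa using (hε n).le, by simp⟩

/-- `add(N) ≤ add(SN(ℝ))`. -/
theorem stmt19 : addOf NullIdeal ≤ addOf SNReal := by
  refine le_csInf ⟨_, range fun x : ℝ => {x}, ?_, ?_, rfl⟩ ?_
  · rintro _ ⟨x, rfl⟩
    exact singleton_mem_SNReal x
  · rw [sUnion_range, iUnion_of_singleton]
    exact univ_notMem_SNReal
  · rintro _ ⟨A, hA, hU, rfl⟩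
    by_contra! h
    exact hU (sUnion_mem_SNReal_of_mk_lt hA h)
end
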